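/- arXiv:math/9904138 — 14 statements merged into one kernel-verified Lean document; each statement's English description precedes it below -/
import Mathlib

section
/- Let s, t, u, v be distinct real numbers and for a real number a define φ(a; x₁₁, x₁₂, x₂₁, x₂₂) = a⁴ − 2a³x₂₁ + a²x₂₂ − 3a²x₁₁ + 2a·x₁₂ + x₁₁x₂₂ − x₁₂x₂₁. Then the set of complex quadruples (x₁₁, x₁₂, x₂₁, x₂₂) satisfying φ(s) = φ(t) = φ(u) = φ(v) = 0 has exactly 2 elements, and every such quadruple has all four coordinates real. -/
/-- The polynomial `φ(a; x₁₁, x₁₂, x₂₁, x₂₂)` of the `m = p = 2` Shapiro–Shapiro system. -/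
noncomputable def phi22 (a : ℝ) (x11 x12 x21 x22 : ℂ) : ℂ :=
  (a : ℂ) ^ 4 - 2 * (a : ℂ) ^ 3 * x21 + (a : ℂ) ^ 2 * x22 - 3 * (a : ℂ) ^ 2 * x11
    + 2 * (a : ℂ) * x12 + x11 * x22 - x12 * x21

/-- The Vieta formulas for a monic quartic with four distinct roots. -/
theorem quartic_vieta_of_distinct_roots {K : Type*} [Field K] {s t u v b c d e : K}
    (hst : s ≠ t) (hsu : s ≠ u) (hsv : s ≠ v) (htu : t ≠ u) (htv : t ≠ v) (huv : u ≠ v)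
    (hs : s ^ 4 + b * s ^ 3 + c * s ^ 2 + d * s + e = 0)
    (ht : t ^ 4 + b * t ^ 3 + c * t ^ 2 + d * t + e = 0)
    (hu : u ^ 4 + b * u ^ 3 + c * u ^ 2 + d * u + e = 0)
    (hv : v ^ 4 + b * v ^ 3 + c * v ^ 2 + d * v + e = 0) :
    b = -(s + t + u + v) ∧ c = s * t + s * u + s * v + t * u + t * v + u * v ∧
      d = -(s * t * u + s * t * v + s * u * v + t * u * v) ∧ e = s * t * u * v := by
  have divided_difference_one {y : K} (hsy : s ≠ y)
      (hy : y ^ 4 + b * y ^ 3 + c * y ^ 2 + d * y + e = 0) :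
      s ^ 3 + s ^ 2 * y + s * y ^ 2 + y ^ 3 + b * (s ^ 2 + s * y + y ^ 2) + c * (s + y) + d
        = 0 := by
    apply mul_left_cancel₀ (sub_ne_zero.mpr hsy)
    linear_combination hs - hy
  have h1 := divided_difference_one hst ht
  have divided_difference_two {y : K} (hsy : s ≠ y) (hty : t ≠ y)
      (hy : y ^ 4 + b * y ^ 3 + c * y ^ 2 + d * y + e = 0) :
      s ^ 2 + t ^ 2 + y ^ 2 + s * t + s * y + t * y + b * (s + t + y) + c = 0 := by
    apply mul_left_cancel₀ (sub_ne_zero.mpr hty)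
    linear_combination h1 - divided_difference_one hsy hy
  have h2 := divided_difference_two hsu htu hu
  have hb : s + t + u + v + b = 0 := by
    apply mul_left_cancel₀ (sub_ne_zero.mpr huv)
    linear_combination h2 - divided_difference_two hsv htv hv
  obtain rfl : b = -(s + t + u + v) := by linear_combination hb
  obtain rfl : c = s * t + s * u + s * v + t * u + t * v + u * v := by linear_combination h2
  obtain rfl : d = -(s * t * u + s * t * v + s * u * v + t * u * v) := by linear_combination h1
  exact ⟨rfl, rfl, rfl, by linear_combination hs⟩

/-- The discriminant of the quadratic equation satisfied by `x₁₁` is positive. -/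
theorem resolvent_discriminant_pos {s t u v : ℝ} (hsv : s ≠ v) (htu : t ≠ u) :
    0 < (s * t + s * u + s * v + t * u + t * v + u * v) ^ 2
      - 3 * ((s + t + u + v) * (s * t * u + s * t * v + s * u * v + t * u * v))
      + 12 * (s * t * u * v) := by
  have h : 0 < ((s - v) * (t - u)) ^ 2 := by
    have := mul_ne_zero (sub_ne_zero.mpr hsv) (sub_ne_zero.mpr htu)
    positivity
  linarith [sq_nonneg ((s - u) * (t - v)), sq_nonneg ((s - t) * (u - v))]

/-- The candidate solution whose discriminant has square root `r`. -/
noncomputable def phi22Solution (s t u v r : ℝ) : ℝ × ℝ × ℝ × ℝ :=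
  ((r - (s * t + s * u + s * v + t * u + t * v + u * v)) / 6,
    -(s * t * u + s * t * v + s * u * v + t * u * v) / 2,
    (s + t + u + v) / 2,
    (r + (s * t + s * u + s * v + t * u + t * v + u * v)) / 2)

/-- The coordinatewise embedding of real quadruples into complex ones. -/
def complexQuadruple (x : ℝ × ℝ × ℝ × ℝ) : ℂ × ℂ × ℂ × ℂ :=
  (x.1, x.2.1, x.2.2.1, x.2.2.2)

theorem phi22_system_iff {s t u v r : ℝ} (hst : s ≠ t) (hsu : s ≠ u) (hsv : s ≠ v)
    (htu : t ≠ u) (htv : t ≠ v) (huv : u ≠ v)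
    (hr : r ^ 2 = (s * t + s * u + s * v + t * u + t * v + u * v) ^ 2
      - 3 * ((s + t + u + v) * (s * t * u + s * t * v + s * u * v + t * u * v))
      + 12 * (s * t * u * v)) (x : ℂ × ℂ × ℂ × ℂ) :
    (phi22 s x.1 x.2.1 x.2.2.1 x.2.2.2 = 0 ∧ phi22 t x.1 x.2.1 x.2.2.1 x.2.2.2 = 0 ∧
      phi22 u x.1 x.2.1 x.2.2.1 x.2.2.2 = 0 ∧ phi22 v x.1 x.2.1 x.2.2.1 x.2.2.2 = 0) ↔
    x = complexQuadruple (phi22Solution s t u v r) ∨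
      x = complexQuadruple (phi22Solution s t u v (-r)) := by
  have hrC : (r : ℂ) ^ 2 = (s * t + s * u + s * v + t * u + t * v + u * v) ^ 2
      - 3 * ((s + t + u + v) * (s * t * u + s * t * v + s * u * v + t * u * v))
      + 12 * (s * t * u * v) := by
    exact_mod_cast hr
  obtain ⟨x11, x12, x21, x22⟩ := x
  simp only [phi22, complexQuadruple, phi22Solution, Prod.mk.injEq]
  push_cast
  constructor
  · rintro ⟨hs, ht, hu, hv⟩
    obtain ⟨h1, h2, h3, h4⟩ := quartic_vieta_of_distinct_roots (K := ℂ)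
      (s := s) (t := t) (u := u) (v := v)
      (b := -2 * x21) (c := x22 - 3 * x11) (d := 2 * x12) (e := x11 * x22 - x12 * x21)
      (by exact_mod_cast hst) (by exact_mod_cast hsu) (by exact_mod_cast hsv)
      (by exact_mod_cast htu) (by exact_mod_cast htv) (by exact_mod_cast huv)
      (by linear_combination hs) (by linear_combination ht) (by linear_combination hu)
      (by linear_combination hv)
    have h21 : x21 = (s + t + u + v) / 2 := by linear_combination -h1 / 2
    have h12 : x12 = -(s * t * u + s * t * v + s * u * v + t * u * v) / 2 := by
      linear_combination h3 / 2
    have h22 : x22 = 3 * x11 + (s * t + s * u + s * v + t * u + t * v + u * v) := by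
      linear_combination h2
    subst h21 h12 h22
    have hfactor : (6 * x11 + (s * t + s * u + s * v + t * u + t * v + u * v) - r)
        * (6 * x11 + (s * t + s * u + s * v + t * u + t * v + u * v) + r) = 0 := by
      linear_combination 12 * h4 - hrC
    rcases mul_eq_zero.mp hfactor with h | h
    · exact .inl ⟨by linear_combination h / 6, rfl, rfl, by linear_combination h / 2⟩
    · exact .inr ⟨by linear_combination h / 6, rfl, rfl, by linear_combination h / 2⟩
  · rintro (⟨rfl, rfl, rfl, rfl⟩ | ⟨rfl, rfl, rfl, rfl⟩) <;>
      refine ⟨?_, ?_, ?_, ?_⟩ <;> linear_combination hrC / 12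

theorem stmt_0 (s t u v : ℝ) (hst : s ≠ t) (hsu : s ≠ u) (hsv : s ≠ v)
    (htu : t ≠ u) (htv : t ≠ v) (huv : u ≠ v) :
    ({x : ℂ × ℂ × ℂ × ℂ |
        phi22 s x.1 x.2.1 x.2.2.1 x.2.2.2 = 0 ∧
        phi22 t x.1 x.2.1 x.2.2.1 x.2.2.2 = 0 ∧
        phi22 u x.1 x.2.1 x.2.2.1 x.2.2.2 = 0 ∧
        phi22 v x.1 x.2.1 x.2.2.1 x.2.2.2 = 0}).ncard = 2 ∧
    ∀ x : ℂ × ℂ × ℂ × ℂ,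
      phi22 s x.1 x.2.1 x.2.2.1 x.2.2.2 = 0 →
      phi22 t x.1 x.2.1 x.2.2.1 x.2.2.2 = 0 →
      phi22 u x.1 x.2.1 x.2.2.1 x.2.2.2 = 0 →
      phi22 v x.1 x.2.1 x.2.2.1 x.2.2.2 = 0 →
      x.1.im = 0 ∧ x.2.1.im = 0 ∧ x.2.2.1.im = 0 ∧ x.2.2.2.im = 0 := by
  obtain ⟨r, hr, hrpos⟩ : ∃ r : ℝ, r ^ 2 = (s * t + s * u + s * v + t * u + t * v + u * v) ^ 2
      - 3 * ((s + t + u + v) * (s * t * u + s * t * v + s * u * v + t * u * v))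
      + 12 * (s * t * u * v) ∧ 0 < r :=
    ⟨_, Real.sq_sqrt (resolvent_discriminant_pos hsv htu).le,
      Real.sqrt_pos.mpr (resolvent_discriminant_pos hsv htu)⟩
  have hiff := phi22_system_iff hst hsu hsv htu htv huv hr
  constructor
  · rw [Set.ext fun x => hiff x]
    refine Set.ncard_pair fun h => ?_
    have h11 : (r - (s * t + s * u + s * v + t * u + t * v + u * v)) / 6
        = (-r - (s * t + s * u + s * v + t * u + t * v + u * v)) / 6 :=
      Complex.ofReal_injective (congrArg Prod.fst h)
    linarith
  · intro x hs ht hu hv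
    rcases (hiff x).mp ⟨hs, ht, hu, hv⟩ with rfl | rfl <;>
      exact ⟨Complex.ofReal_im _, Complex.ofReal_im _, Complex.ofReal_im _, Complex.ofReal_im _⟩
end

section
/- Let s, t, u, v be distinct real numbers, let e₁, e₂, e₃, e₄ denote the elementary symmetric polynomials of s, t, u, v, and let φ(a; x₁₁, x₁₂, x₂₁, x₂₂) = a⁴ − 2a³x₂₁ + a²x₂₂ − 3a²x₁₁ + 2a·x₁₂ + x₁₁x₂₂ − x₁₂x₂₁. Then every complex quadruple (x₁₁, x₁₂, x₂₁, x₂₂) satisfying φ(s) = φ(t) = φ(u) = φ(v) = 0 also satisfies 2x₂₁ − e₁ = 0, x₂₂ − 3x₁₁ − e₂ = 0, 2x₁₂ + e₃ = 0, and 12x₁₁² + 4e₂x₁₁ + e₁e₃ − 4e₄ = 0. -/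
/-- Vieta's formulas for a monic quartic with four distinct roots in an integral domain. -/
theorem vieta_quartic_of_distinct_roots {R : Type*} [CommRing R] [IsDomain R]
    {s t u v b c d e : R} (hst : s ≠ t) (hsu : s ≠ u) (hsv : s ≠ v)
    (htu : t ≠ u) (htv : t ≠ v) (huv : u ≠ v)
    (hs : s ^ 4 + b * s ^ 3 + c * s ^ 2 + d * s + e = 0)
    (ht : t ^ 4 + b * t ^ 3 + c * t ^ 2 + d * t + e = 0)
    (hu : u ^ 4 + b * u ^ 3 + c * u ^ 2 + d * u + e = 0)
    (hv : v ^ 4 + b * v ^ 3 + c * v ^ 2 + d * v + e = 0) :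
    b = -(s + t + u + v) ∧
    c = s * t + s * u + s * v + t * u + t * v + u * v ∧
    d = -(s * t * u + s * t * v + s * u * v + t * u * v) ∧
    e = s * t * u * v := by
  have first_diff : ∀ y : R, s ≠ y → y ^ 4 + b * y ^ 3 + c * y ^ 2 + d * y + e = 0 →
      s ^ 3 + s ^ 2 * y + s * y ^ 2 + y ^ 3 + b * (s ^ 2 + s * y + y ^ 2) + c * (s + y) + d
        = 0 := fun y hne hy =>
    mul_left_cancel₀ (sub_ne_zero.mpr hne) (by linear_combination hs - hy)
  have hdt := first_diff t hst ht
  have second_diff : ∀ y : R, s ≠ y → t ≠ y →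
      y ^ 4 + b * y ^ 3 + c * y ^ 2 + d * y + e = 0 →
      s ^ 2 + t ^ 2 + y ^ 2 + s * t + s * y + t * y + b * (s + t + y) + c = 0 :=
    fun y hsy hty hy =>
      mul_left_cancel₀ (sub_ne_zero.mpr hty) (by linear_combination hdt - first_diff y hsy hy)
  have hddu := second_diff u hsu htu hu
  have hb : s + t + u + v + b = 0 :=
    mul_left_cancel₀ (sub_ne_zero.mpr huv)
      (by linear_combination hddu - second_diff v hsv htv hv)
  obtain rfl : b = -(s + t + u + v) := by linear_combination hb
  obtain rfl : c = s * t + s * u + s * v + t * u + t * v + u * v := by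
    linear_combination hddu
  obtain rfl : d = -(s * t * u + s * t * v + s * u * v + t * u * v) := by
    linear_combination hdt
  exact ⟨rfl, rfl, rfl, by linear_combination hs⟩

theorem stmt_1 (s t u v : ℝ) (hst : s ≠ t) (hsu : s ≠ u) (hsv : s ≠ v)
    (htu : t ≠ u) (htv : t ≠ v) (huv : u ≠ v)
    (e1 e2 e3 e4 : ℝ)
    (he1 : e1 = s + t + u + v)
    (he2 : e2 = s * t + s * u + s * v + t * u + t * v + u * v)
    (he3 : e3 = s * t * u + s * t * v + s * u * v + t * u * v)
    (he4 : e4 = s * t * u * v)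
    (x11 x12 x21 x22 : ℂ)
    (hs : phi22 s x11 x12 x21 x22 = 0)
    (ht : phi22 t x11 x12 x21 x22 = 0)
    (hu : phi22 u x11 x12 x21 x22 = 0)
    (hv : phi22 v x11 x12 x21 x22 = 0) :
    2 * x21 - (e1 : ℂ) = 0 ∧
    x22 - 3 * x11 - (e2 : ℂ) = 0 ∧
    2 * x12 + (e3 : ℂ) = 0 ∧
    12 * x11 ^ 2 + 4 * (e2 : ℂ) * x11 + (e1 : ℂ) * (e3 : ℂ) - 4 * (e4 : ℂ) = 0 := by
  unfold phi22 at hs ht hu hv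
  subst he1 he2 he3 he4
  obtain ⟨hb, hc, hd, he⟩ := vieta_quartic_of_distinct_roots
    (s := (s : ℂ)) (t := t) (u := u) (v := v) (b := -2 * x21) (c := x22 - 3 * x11)
    (d := 2 * x12) (e := x11 * x22 - x12 * x21)
    (by exact_mod_cast hst) (by exact_mod_cast hsu) (by exact_mod_cast hsv)
    (by exact_mod_cast htu) (by exact_mod_cast htv) (by exact_mod_cast huv)
    (by linear_combination hs) (by linear_combination ht)
    (by linear_combination hu) (by linear_combination hv)
  push_cast
  refine ⟨by linear_combination -hb, by linear_combination hc, by linear_combination hd, ?_⟩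
  linear_combination 4 * he - 4 * x11 * hc + 2 * x21 * hd
    + (s * t * u + s * t * v + s * u * v + t * u * v : ℂ) * hb
end

section
/- For all real numbers s, t, u, v, letting e₁, e₂, e₃, e₄ denote the elementary symmetric polynomials of s, t, u, v, one has the identity 16e₂² − 48e₁e₃ + 192e₄ = 8((s−t)²(u−v)² + (s−u)²(t−v)² + (s−v)²(t−u)²). In particular, if s, t, u, v are distinct, then 16e₂² − 48e₁e₃ + 192e₄ > 0. -/
theorem stmt_2 (s t u v : ℝ)
    (e1 e2 e3 e4 : ℝ)
    (he1 : e1 = s + t + u + v)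
    (he2 : e2 = s * t + s * u + s * v + t * u + t * v + u * v)
    (he3 : e3 = s * t * u + s * t * v + s * u * v + t * u * v)
    (he4 : e4 = s * t * u * v) :
    16 * e2 ^ 2 - 48 * e1 * e3 + 192 * e4 =
      8 * ((s - t) ^ 2 * (u - v) ^ 2 + (s - u) ^ 2 * (t - v) ^ 2
        + (s - v) ^ 2 * (t - u) ^ 2) ∧
    (s ≠ t → s ≠ u → s ≠ v → t ≠ u → t ≠ v → u ≠ v →
      0 < 16 * e2 ^ 2 - 48 * e1 * e3 + 192 * e4) := by
  have identity : 16 * e2 ^ 2 - 48 * e1 * e3 + 192 * e4 =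
      8 * ((s - t) ^ 2 * (u - v) ^ 2 + (s - u) ^ 2 * (t - v) ^ 2
        + (s - v) ^ 2 * (t - u) ^ 2) := by
    subst he1 he2 he3 he4
    ring
  refine ⟨identity, fun hst _ _ _ _ huv => ?_⟩
  have hst' := sub_ne_zero.mpr hst
  have huv' := sub_ne_zero.mpr huv
  rw [identity]
  positivity
end

section
/- Let s, t, u, v be distinct real numbers and let e₁, e₂, e₃, e₄ denote the elementary symmetric polynomials of s, t, u, v. Then the quintic polynomial g(x) = x⁵ − 4e₁x⁴ + (4e₁² + 6e₂)x³ − (12e₁e₂ + 4e₃)x² + (9e₂² + 8e₁e₃ − 4e₄)x − (12e₂e₃ − 8e₁e₄) has five distinct real roots. -/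
section

open Finset Matrix

/-- If `w` is the orbit of a vector under a real symmetric matrix, its first `d` terms are linearly
independent and `∑ c k • w k = 0`, then `∑ c k * X ^ k` has at least `d` distinct real roots. -/
theorem Matrix.IsHermitian.exists_finset_roots_of_krylov {n : Type*} [Fintype n] [DecidableEq n]
    {A : Matrix n n ℝ} (hA : A.IsHermitian) {w : ℕ → n → ℝ} (hw : ∀ k, A *ᵥ w k = w (k + 1))
    {d m : ℕ} (hind : ∀ f : ℕ → ℝ, (∀ i, ∑ k ∈ range d, f k * w k i = 0) → ∀ k < d, f k = 0)
    {c : ℕ → ℝ} (hc : ∀ i, ∑ k ∈ range m, c k * w k i = 0) :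
    ∃ S : Finset ℝ, S.card = d ∧ ∀ x ∈ S, ∑ k ∈ range m, c k * x ^ k = 0 := by
  classical
  let b : n → n → ℝ := fun i ↦ (hA.eigenvectorBasis i).ofLp
  have hb (i : n) : A *ᵥ b i = hA.eigenvalues i • b i := hA.mulVec_eigenvectorBasis i
  have hsymm : Aᵀ = A := by
    rw [← conjTranspose_eq_transpose_of_trivial]; exact hA
  have hcoord (i : n) (k : ℕ) : b i ⬝ᵥ w k = hA.eigenvalues i ^ k * (b i ⬝ᵥ w 0) := by
    induction k with
    | zero => simp
    | succ k ih =>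
      rw [← hw, dotProduct_mulVec, ← mulVec_transpose, hsymm, hb, smul_dotProduct, ih, pow_succ']
      simp [mul_assoc]
  have hcomb (f : ℕ → ℝ) (N : ℕ) (i : n) :
      b i ⬝ᵥ (∑ k ∈ range N, f k • w k)
        = (∑ k ∈ range N, f k * hA.eigenvalues i ^ k) * (b i ⬝ᵥ w 0) := by
    rw [dotProduct_sum, sum_mul]
    refine sum_congr rfl fun k _ ↦ ?_
    rw [dotProduct_smul, hcoord, smul_eq_mul, mul_assoc]
  have hsep (x : n → ℝ) (hx : ∀ i, b i ⬝ᵥ x = 0) : x = 0 := by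
    have : WithLp.toLp 2 x = (0 : EuclideanSpace ℝ n) := by
      refine InnerProductSpace.ext_inner_left_basis hA.eigenvectorBasis.toBasis fun i ↦ ?_
      simpa [EuclideanSpace.inner_eq_star_dotProduct, dotProduct_comm] using hx i
    simpa using this
  let S : Finset ℝ := (univ.filter fun i ↦ b i ⬝ᵥ w 0 ≠ 0).image hA.eigenvalues
  have hroot : ∀ x ∈ S, ∑ k ∈ range m, c k * x ^ k = 0 := by
    intro x hx
    obtain ⟨i, hi, rfl⟩ := mem_image.1 hx
    have hzero : ∑ k ∈ range m, c k • w k = 0 := by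
      ext j; simpa using hc j
    have := hcomb c m i
    rw [hzero, dotProduct_zero, eq_comm, mul_eq_zero] at this
    exact this.resolve_right (mem_filter.1 hi).2
  have hcard : d ≤ S.card := by
    by_contra! hlt
    let p : Polynomial ℝ := ∏ x ∈ S, (Polynomial.X - Polynomial.C x)
    have hp : p.Monic := Polynomial.monic_prod_of_monic _ _ fun x _ ↦ Polynomial.monic_X_sub_C x
    have hdeg : p.natDegree = S.card := by
      simp [p]
    have hvanish : ∑ k ∈ range d, p.coeff k • w k = 0 := by
      refine hsep _ fun i ↦ ?_
      rw [hcomb, ← Polynomial.eval_eq_sum_range' (hdeg ▸ hlt)]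
      by_cases hi : b i ⬝ᵥ w 0 = 0
      · rw [hi, mul_zero]
      · have hmem : hA.eigenvalues i ∈ S := mem_image_of_mem _ (by simpa using hi)
        rw [Polynomial.eval_prod, prod_eq_zero hmem (by simp), zero_mul]
    have hlead := hind p.coeff (fun i ↦ by simpa using congrFun hvanish i) S.card hlt
    rw [← hdeg, hp.coeff_natDegree] at hlead
    exact one_ne_zero hlead
  obtain ⟨R, hRS, hR⟩ := exists_subset_card_eq hcard
  exact ⟨R, hR, fun x hx ↦ hroot x (hRS hx)⟩

/-- `pairKrylov k a b c d e` is the value at the pair `{a, b}` of the `k`-th iterate of the operator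
`∑ (zᵢ + zⱼ) (i j)` (sum over the transpositions of the points `a, b, c, d, e`) on functions of
pairs, started from the quadratic covariant of the five points with vanishing vertex sums. -/
def pairKrylov : ℕ → ℝ → ℝ → ℝ → ℝ → ℝ → ℝ
  | 0, a, b, c, d, e => 3 * (a * b) - (a + b) * (c + d + e) + (c * d + c * e + d * e)
  | k + 1, a, b, c, d, e =>
    (a + b + 2 * (c + d + e)) * pairKrylov k a b c d e
      + (b + c) * pairKrylov k a c b d e + (b + d) * pairKrylov k a d b c e
      + (b + e) * pairKrylov k a e b c d + (a + c) * pairKrylov k b c a d e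
      + (a + d) * pairKrylov k b d a c e + (a + e) * pairKrylov k b e a c d

theorem pairKrylov_zero (a b c d e : ℝ) :
    pairKrylov 0 a b c d e = 3 * (a * b) - (a + b) * (c + d + e) + (c * d + c * e + d * e) :=
  rfl

theorem pairKrylov_succ (k : ℕ) (a b c d e : ℝ) :
    pairKrylov (k + 1) a b c d e =
      (a + b + 2 * (c + d + e)) * pairKrylov k a b c d e
        + (b + c) * pairKrylov k a c b d e + (b + d) * pairKrylov k a d b c e
        + (b + e) * pairKrylov k a e b c d + (a + c) * pairKrylov k b c a d e
        + (a + d) * pairKrylov k b d a c e + (a + e) * pairKrylov k b e a c d :=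
  rfl

theorem pairKrylov_swap_pair (k : ℕ) (a b c d e : ℝ) :
    pairKrylov k a b c d e = pairKrylov k b a c d e := by
  induction k with
  | zero => simp only [pairKrylov]; ring
  | succ k ih => simp only [pairKrylov]; rw [ih]; ring

/-- The three points outside the pair may be permuted. -/
theorem pairKrylov_swap_rest (k : ℕ) (a b c d e : ℝ) :
    pairKrylov k a b c d e = pairKrylov k a b d c e ∧
      pairKrylov k a b c d e = pairKrylov k a b c e d := by
  induction k generalizing a b c d e with
  | zero => simp only [pairKrylov]; constructor <;> ring
  | succ k ih =>
    simp only [pairKrylov]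
    constructor
    · rw [(ih a b c d e).1, (ih a e b c d).2, (ih b e a c d).2]; ring
    · rw [(ih a b c d e).2, (ih a c b d e).2, (ih b c a d e).2]; ring

theorem pairKrylov_one (a b c d e : ℝ) :
    pairKrylov 1 a b c d e =
      4 * (a * b) * (c + d + e) - 4 * (a + b) * (c * d + c * e + d * e) + 12 * (c * d * e) := by
  simp only [pairKrylov]
  ring

theorem pairKrylov_two (a b c d e m n p q r : ℝ) (hm : m = a + b) (hn : n = a * b)
    (hp : p = c + d + e) (hq : q = c * d + c * e + d * e) (hr : r = c * d * e) :
    pairKrylov 2 a b c d e =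
      16 * n * p ^ 2 - 32 * n * q - 8 * m * p * q + 24 * m * r + 16 * p * r := by
  subst hm hn hp hq hr
  rw [pairKrylov]
  simp only [pairKrylov_one]
  ring

theorem pairKrylov_three (a b c d e m n p q r : ℝ) (hm : m = a + b) (hn : n = a * b)
    (hp : p = c + d + e) (hq : q = c * d + c * e + d * e) (hr : r = c * d * e) :
    pairKrylov 3 a b c d e =
      16 * m * n * p ^ 2 - 48 * m * n * q - 8 * m ^ 2 * p * q + 72 * m ^ 2 * r + 32 * n * p ^ 3
        - 64 * n * p * q - 96 * n * r - 16 * m * p ^ 2 * q + 16 * m * q ^ 2 + 32 * m * p * r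
        + 32 * p ^ 2 * r - 32 * q * r := by
  subst hm hn hp hq hr
  rw [pairKrylov]
  simp only [pairKrylov_two _ _ _ _ _ _ _ _ _ _ rfl rfl rfl rfl rfl]
  ring

theorem pairKrylov_four (a b c d e m n p q r : ℝ) (hm : m = a + b) (hn : n = a * b)
    (hp : p = c + d + e) (hq : q = c * d + c * e + d * e) (hr : r = c * d * e) :
    pairKrylov 4 a b c d e =
      32 * m ^ 2 * n * p ^ 2 - 96 * m ^ 2 * n * q - 16 * m ^ 3 * p * q + 144 * m ^ 3 * r
        - 32 * n ^ 2 * p ^ 2 + 96 * n ^ 2 * q + 48 * m * n * p ^ 3 - 120 * m * n * p * q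
        - 216 * m * n * r - 24 * m ^ 2 * p ^ 2 * q + 16 * m ^ 2 * q ^ 2 + 168 * m ^ 2 * p * r
        + 64 * n * p ^ 4 - 176 * n * p ^ 2 * q + 160 * n * q ^ 2 - 368 * n * p * r
        - 32 * m * p ^ 3 * q + 56 * m * p * q ^ 2 + 80 * m * p ^ 2 * r - 136 * m * q * r
        + 64 * p ^ 3 * r - 112 * p * q * r + 48 * r ^ 2 := by
  subst hm hn hp hq hr
  rw [pairKrylov]
  simp only [pairKrylov_three _ _ _ _ _ _ _ _ _ _ rfl rfl rfl rfl rfl]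
  ring

theorem pairKrylov_relation_zero_left (s t u v e1 e2 e3 e4 : ℝ)
    (he1 : e1 = s + t + u + v)
    (he2 : e2 = s * t + s * u + s * v + t * u + t * v + u * v)
    (he3 : e3 = s * t * u + s * t * v + s * u * v + t * u * v)
    (he4 : e4 = s * t * u * v) :
    pairKrylov 5 0 s t u v - 4 * e1 * pairKrylov 4 0 s t u v
      + (4 * e1 ^ 2 + 6 * e2) * pairKrylov 3 0 s t u v
      - (12 * e1 * e2 + 4 * e3) * pairKrylov 2 0 s t u v
      + (9 * e2 ^ 2 + 8 * e1 * e3 - 4 * e4) * pairKrylov 1 0 s t u v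
      - (12 * e2 * e3 - 8 * e1 * e4) * pairKrylov 0 0 s t u v = 0 := by
  subst he1 he2 he3 he4
  rw [pairKrylov_succ 4]
  simp only [pairKrylov_four _ _ _ _ _ _ _ _ _ _ rfl rfl rfl rfl rfl,
    pairKrylov_three _ _ _ _ _ _ _ _ _ _ rfl rfl rfl rfl rfl,
    pairKrylov_two _ _ _ _ _ _ _ _ _ _ rfl rfl rfl rfl rfl, pairKrylov_one, pairKrylov_zero]
  ring

theorem pairKrylov_relation_zero_right (s t u v e1 e2 e3 e4 : ℝ)
    (he1 : e1 = s + t + u + v)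
    (he2 : e2 = s * t + s * u + s * v + t * u + t * v + u * v)
    (he3 : e3 = s * t * u + s * t * v + s * u * v + t * u * v)
    (he4 : e4 = s * t * u * v) :
    pairKrylov 5 s t 0 u v - 4 * e1 * pairKrylov 4 s t 0 u v
      + (4 * e1 ^ 2 + 6 * e2) * pairKrylov 3 s t 0 u v
      - (12 * e1 * e2 + 4 * e3) * pairKrylov 2 s t 0 u v
      + (9 * e2 ^ 2 + 8 * e1 * e3 - 4 * e4) * pairKrylov 1 s t 0 u v
      - (12 * e2 * e3 - 8 * e1 * e4) * pairKrylov 0 s t 0 u v = 0 := by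
  subst he1 he2 he3 he4
  rw [pairKrylov_succ 4]
  simp only [pairKrylov_four _ _ _ _ _ _ _ _ _ _ rfl rfl rfl rfl rfl,
    pairKrylov_three _ _ _ _ _ _ _ _ _ _ rfl rfl rfl rfl rfl,
    pairKrylov_two _ _ _ _ _ _ _ _ _ _ rfl rfl rfl rfl rfl, pairKrylov_one, pairKrylov_zero]
  ring

/-- For a combination `F` of the first five iterates, eliminating `f 0` and `f 1` between two ways of
splitting `a, b, c, d` into pairs leaves a relation quadratic in the remaining point `e`. -/
theorem pairKrylov_elim (f : ℕ → ℝ) (F : ℝ → ℝ → ℝ → ℝ → ℝ → ℝ)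
    (hF : ∀ a b c d e, F a b c d e = ∑ k ∈ range 5, f k * pairKrylov k a b c d e)
    (a b c d e p q : ℝ) (hp : p = a + b + c + d + e)
    (hq : q = a * b + a * c + a * d + a * e + b * c + b * d + b * e + c * d + c * e + d * e) :
    (a - c) * (b - d) * (F a c b d e - F a d b c e - F b c a d e + F b d a c e)
      - (a - b) * (c - d) * (F a b c d e - F a d b c e - F b c a d e + F c d a b e)
      = -24 * ((a - b) * (a - c) * (a - d) * (b - c) * (b - d) * (c - d)) *
        (f 2 + 2 * (p + e) * f 3 + (4 * p ^ 2 - 3 * q + 4 * e * p + 6 * e ^ 2) * f 4) := by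
  subst hp hq
  simp only [hF, sum_range_succ, sum_range_zero, zero_add]
  simp only [pairKrylov_four _ _ _ _ _ _ _ _ _ _ rfl rfl rfl rfl rfl,
    pairKrylov_three _ _ _ _ _ _ _ _ _ _ rfl rfl rfl rfl rfl,
    pairKrylov_two _ _ _ _ _ _ _ _ _ _ rfl rfl rfl rfl rfl, pairKrylov_one, pairKrylov_zero]
  ring

/-- The operator `∑ (zᵢ + zⱼ) (i j)` on functions of the pairs `ab, ac, ad, ae, bc, bd, be, cd, ce, de`
of points of `{a, b, c, d, e}`, the transpositions permuting the five points. -/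
def pairMatrix (a b c d e : ℝ) : Matrix (Fin 10) (Fin 10) ℝ :=
  !![a + b + 2 * (c + d + e), b + c, b + d, b + e, a + c, a + d, a + e, 0, 0, 0;
     b + c, a + c + 2 * (b + d + e), c + d, c + e, a + b, 0, 0, a + d, a + e, 0;
     b + d, c + d, a + d + 2 * (b + c + e), d + e, 0, a + b, 0, a + c, 0, a + e;
     b + e, c + e, d + e, a + e + 2 * (b + c + d), 0, 0, a + b, 0, a + c, a + d;
     a + c, a + b, 0, 0, b + c + 2 * (a + d + e), c + d, c + e, b + d, b + e, 0;
     a + d, 0, a + b, 0, c + d, b + d + 2 * (a + c + e), d + e, b + c, 0, b + e;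
     a + e, 0, 0, a + b, c + e, d + e, b + e + 2 * (a + c + d), 0, b + c, b + d;
     0, a + d, a + c, 0, b + d, b + c, 0, c + d + 2 * (a + b + e), d + e, c + e;
     0, a + e, 0, a + c, b + e, 0, b + c, d + e, c + e + 2 * (a + b + d), c + d;
     0, 0, a + e, a + d, 0, b + e, b + d, c + e, c + d, d + e + 2 * (a + b + c)]

/-- The values of `pairKrylov k` at the ten pairs of points of `{a, b, c, d, e}`. -/
def pairVec (a b c d e : ℝ) (k : ℕ) : Fin 10 → ℝ :=
  ![pairKrylov k a b c d e, pairKrylov k a c b d e, pairKrylov k a d b c e,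
    pairKrylov k a e b c d, pairKrylov k b c a d e, pairKrylov k b d a c e,
    pairKrylov k b e a c d, pairKrylov k c d a b e, pairKrylov k c e a b d,
    pairKrylov k d e a b c]

theorem pairMatrix_isHermitian (a b c d e : ℝ) : (pairMatrix a b c d e).IsHermitian := by
  ext i j
  fin_cases i <;> fin_cases j <;> rfl

theorem pairMatrix_mulVec_pairVec (a b c d e : ℝ) (k : ℕ) :
    pairMatrix a b c d e *ᵥ pairVec a b c d e k = pairVec a b c d e (k + 1) := by
  have h₁ := pairKrylov_swap_pair k
  have h₂ := fun a b c d e ↦ (pairKrylov_swap_rest k a b c d e).1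
  have h₃ := fun a b c d e ↦ (pairKrylov_swap_rest k a b c d e).2
  ext i
  fin_cases i <;>
    simp [pairMatrix, pairVec, mulVec, dotProduct, Fin.sum_univ_succ, pairKrylov_succ, h₁, h₂, h₃] <;>
    ring

theorem pairVec_independent {a b c d e : ℝ} (hab : a ≠ b) (hac : a ≠ c) (had : a ≠ d)
    (hae : a ≠ e) (hbc : b ≠ c) (hbd : b ≠ d) (hbe : b ≠ e) (hcd : c ≠ d) (hce : c ≠ e)
    (hde : d ≠ e) (f : ℕ → ℝ) (hf : ∀ i, ∑ k ∈ range 5, f k * pairVec a b c d e k i = 0) :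
    ∀ k < 5, f k = 0 := by
  let F (a b c d e : ℝ) : ℝ := ∑ k ∈ range 5, f k * pairKrylov k a b c d e
  have swap_left (a b c d e : ℝ) : F a b c d e = F a b d c e := by
    simp only [F, (pairKrylov_swap_rest _ a b c d e).1]
  have swap_right (a b c d e : ℝ) : F a b c d e = F a b c e d := by
    simp only [F, (pairKrylov_swap_rest _ a b c d e).2]
  have Fab : F a b c d e = 0 := hf 0
  have Fac : F a c b d e = 0 := hf 1
  have Fad : F a d b c e = 0 := hf 2
  have Fae : F a e b c d = 0 := hf 3
  have Fbc : F b c a d e = 0 := hf 4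
  have Fbd : F b d a c e = 0 := hf 5
  have Fbe : F b e a c d = 0 := hf 6
  have Fcd : F c d a b e = 0 := hf 7
  have Fce : F c e a b d = 0 := hf 8
  have Fde : F d e a b c = 0 := hf 9
  let p := a + b + c + d + e
  let q := a * b + a * c + a * d + a * e + b * c + b * d + b * e + c * d + c * e + d * e
  let r (z : ℝ) : ℝ := f 2 + 2 * (p + z) * f 3 + (4 * p ^ 2 - 3 * q + 4 * z * p + 6 * z ^ 2) * f 4
  have re : r e = 0 := by
    have h := pairKrylov_elim f F (fun _ _ _ _ _ ↦ rfl) a b c d e p q (by ring) (by ring)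
    rw [Fab, Fac, Fad, Fbc, Fbd, Fcd] at h
    simpa [sub_eq_zero, *] using h
  have rd : r d = 0 := by
    have h := pairKrylov_elim f F (fun _ _ _ _ _ ↦ rfl) a b c e d p q (by ring) (by ring)
    rw [swap_right a b c, swap_right a c b, swap_right b c a, Fab, Fac, Fae, Fbc, Fbe, Fce] at h
    simpa [sub_eq_zero, *] using h
  have rc : r c = 0 := by
    have h := pairKrylov_elim f F (fun _ _ _ _ _ ↦ rfl) a b d e c p q (by ring) (by ring)
    rw [swap_right a b d, swap_left a b d,
      swap_right a d b, swap_right b d a, swap_right a e b, swap_right b e a,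
      Fab, Fad, Fae, Fbd, Fbe, Fde] at h
    simpa [sub_eq_zero, *] using h
  have hed : 2 * f 3 + (4 * p + 6 * (e + d)) * f 4 = 0 :=
    mul_left_cancel₀ (sub_ne_zero.2 hde) (by linear_combination rd - re)
  have hec : 2 * f 3 + (4 * p + 6 * (e + c)) * f 4 = 0 :=
    mul_left_cancel₀ (sub_ne_zero.2 hce) (by linear_combination rc - re)
  have f4 : f 4 = 0 :=
    mul_left_cancel₀ (sub_ne_zero.2 hcd) (by linear_combination (hec - hed) / 6)
  have f3 : f 3 = 0 := by
    rw [f4] at hed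
    linarith
  have f2 : f 2 = 0 := by
    have h := re
    simp only [r, f3, f4] at h
    linarith
  have le : f 0 + 4 * e * f 1 = 0 := by
    refine mul_left_cancel₀ (mul_ne_zero (sub_ne_zero.2 hab) (sub_ne_zero.2 hcd)) ?_
    have h : F a c b d e - F a d b c e - F b c a d e + F b d a c e = 0 := by
      rw [Fac, Fad, Fbc, Fbd]; ring
    simp only [F, sum_range_succ, sum_range_zero, f2, f3, f4, pairKrylov_one, pairKrylov_zero] at h
    linear_combination h / 6
  have ld : f 0 + 4 * d * f 1 = 0 := by
    refine mul_left_cancel₀ (mul_ne_zero (sub_ne_zero.2 hab) (sub_ne_zero.2 hce)) ?_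
    have h : F a c b d e - F a e b c d - F b c a d e + F b e a c d = 0 := by
      rw [Fac, Fae, Fbc, Fbe]; ring
    simp only [F, sum_range_succ, sum_range_zero, f2, f3, f4, pairKrylov_one, pairKrylov_zero] at h
    linear_combination h / 6
  have f1 : f 1 = 0 :=
    mul_left_cancel₀ (sub_ne_zero.2 hde) (by linear_combination (ld - le) / 4)
  have f0 : f 0 = 0 := by
    rw [f1] at le
    linarith
  intro k hk
  interval_cases k <;> assumption

open Polynomial in
theorem exists_three_roots_cubic {t u v : ℝ} (ht : t ≠ 0) (hu : u ≠ 0) (hv : v ≠ 0)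
    (htu : t ≠ u) (htv : t ≠ v) (huv : u ≠ v) :
    ∃ S : Finset ℝ, S.card = 3 ∧ ∀ x ∈ S, x ^ 3 - 2 * (t + u + v) * x ^ 2
      + 3 * (t * u + t * v + u * v) * x - 4 * (t * u * v) = 0 := by
  classical
  let p : ℝ[X] := X * (1 - C t * X) * (1 - C u * X) * (1 - C v * X)
  have hp0 : p ≠ 0 := by
    intro h
    have := congrArg (fun q : ℝ[X] ↦ q.derivative.eval 0) h
    simp [p] at this
  have hroots : ({0, t⁻¹, u⁻¹, v⁻¹} : Finset ℝ) ⊆ p.roots.toFinset := by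
    intro x hx
    rw [Multiset.mem_toFinset, mem_roots hp0]
    simp only [mem_insert, mem_singleton] at hx
    rcases hx with rfl | rfl | rfl | rfl <;> simp [p, *]
  have hfour : ({0, t⁻¹, u⁻¹, v⁻¹} : Finset ℝ).card = 4 := by
    rw [card_insert_of_notMem, card_insert_of_notMem, card_insert_of_notMem, card_singleton] <;>
      simp [*, eq_comm]
  have hthree : 3 ≤ p.derivative.roots.toFinset.card := by
    have := card_roots_toFinset_le_derivative p
    have := card_le_card hroots
    omega
  obtain ⟨R, hR, hcard⟩ := exists_subset_card_eq hthree
  refine ⟨R.image (·⁻¹), by rw [card_image_of_injective _ inv_injective, hcard], fun x hx ↦ ?_⟩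
  obtain ⟨y, hy, rfl⟩ := mem_image.1 hx
  have hroot : p.derivative.eval y = 0 := by
    have := Multiset.mem_toFinset.1 (hR hy)
    exact (mem_roots'.1 this).2
  have hy0 : y ≠ 0 := by
    rintro rfl
    simp [p] at hroot
  simp [p] at hroot
  field_simp
  linear_combination hroot

theorem exists_five_roots_of_zero {t u v : ℝ} (ht : t ≠ 0) (hu : u ≠ 0) (hv : v ≠ 0)
    (htu : t ≠ u) (htv : t ≠ v) (huv : u ≠ v) :
    ∃ S : Finset ℝ, S.card = 5 ∧ ∀ x ∈ S,
      (x ^ 2 - 2 * (t + u + v) * x + 3 * (t * u + t * v + u * v)) *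
        (x ^ 3 - 2 * (t + u + v) * x ^ 2 + 3 * (t * u + t * v + u * v) * x
          - 4 * (t * u * v)) = 0 := by
  obtain ⟨S, hS, hroot⟩ := exists_three_roots_cubic ht hu hv htu htv huv
  have hδ : 0 < (t + u + v) ^ 2 - 3 * (t * u + t * v + u * v) := by
    nlinarith [sq_pos_of_ne_zero (sub_ne_zero.2 htu), sq_nonneg (t - v), sq_nonneg (u - v)]
  set δ := (t + u + v) ^ 2 - 3 * (t * u + t * v + u * v) with hδ_def
  have hsq := Real.sq_sqrt hδ.le
  have hpos := Real.sqrt_pos.2 hδ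
  let Q : Finset ℝ := {t + u + v - √δ, t + u + v + √δ}
  have hQ : ∀ x ∈ Q, x ^ 2 - 2 * (t + u + v) * x + 3 * (t * u + t * v + u * v) = 0 := by
    intro x hx
    simp only [Q, mem_insert, mem_singleton] at hx
    rcases hx with rfl | rfl <;> linear_combination hsq + hδ_def
  have hcard : Q.card = 2 := card_pair (by linarith)
  have hdisj : Disjoint S Q := by
    refine disjoint_left.2 fun x hx hxQ ↦ ?_
    have : 4 * (t * u * v) = 0 := by linear_combination x * hQ x hxQ - hroot x hx
    simp_all
  refine ⟨S ∪ Q, by rw [card_union_of_disjoint hdisj, hS, hcard], fun x hx ↦ ?_⟩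
  rcases mem_union.1 hx with hx | hx
  · rw [hroot x hx, mul_zero]
  · rw [hQ x hx, zero_mul]

/-- The nondegenerate case: together with `0` the points are five distinct reals. -/
theorem exists_five_roots_of_ne_zero {s t u v : ℝ} (hs : s ≠ 0) (ht : t ≠ 0) (hu : u ≠ 0)
    (hv : v ≠ 0) (hst : s ≠ t) (hsu : s ≠ u) (hsv : s ≠ v) (htu : t ≠ u) (htv : t ≠ v)
    (huv : u ≠ v) (e1 e2 e3 e4 : ℝ)
    (he1 : e1 = s + t + u + v)
    (he2 : e2 = s * t + s * u + s * v + t * u + t * v + u * v)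
    (he3 : e3 = s * t * u + s * t * v + s * u * v + t * u * v)
    (he4 : e4 = s * t * u * v) :
    ∃ S : Finset ℝ, S.card = 5 ∧ ∀ x ∈ S, x ^ 5 - 4 * e1 * x ^ 4 + (4 * e1 ^ 2 + 6 * e2) * x ^ 3
      - (12 * e1 * e2 + 4 * e3) * x ^ 2 + (9 * e2 ^ 2 + 8 * e1 * e3 - 4 * e4) * x
      - (12 * e2 * e3 - 8 * e1 * e4) = 0 := by
  let c : ℕ → ℝ
    | 0 => -(12 * e2 * e3 - 8 * e1 * e4)
    | 1 => 9 * e2 ^ 2 + 8 * e1 * e3 - 4 * e4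
    | 2 => -(12 * e1 * e2 + 4 * e3)
    | 3 => 4 * e1 ^ 2 + 6 * e2
    | 4 => -4 * e1
    | _ => 1
  have hsum (y : ℕ → ℝ) : ∑ k ∈ range 6, c k * y k
      = y 5 - 4 * e1 * y 4 + (4 * e1 ^ 2 + 6 * e2) * y 3 - (12 * e1 * e2 + 4 * e3) * y 2
        + (9 * e2 ^ 2 + 8 * e1 * e3 - 4 * e4) * y 1 - (12 * e2 * e3 - 8 * e1 * e4) * y 0 := by
    simp only [sum_range_succ, sum_range_zero, c]
    ring
  have hrel (i : Fin 10) : ∑ k ∈ range 6, c k * pairVec 0 s t u v k i = 0 := by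
    rw [hsum]
    have left (x y z w : ℝ) (h1 h2 h3 h4) :=
      pairKrylov_relation_zero_left x y z w e1 e2 e3 e4
        (he1.trans h1) (he2.trans h2) (he3.trans h3) (he4.trans h4)
    have right (x y z w : ℝ) (h1 h2 h3 h4) :=
      pairKrylov_relation_zero_right x y z w e1 e2 e3 e4
        (he1.trans h1) (he2.trans h2) (he3.trans h3) (he4.trans h4)
    fin_cases i
    · exact left s t u v (by ring) (by ring) (by ring) (by ring)
    · exact left t s u v (by ring) (by ring) (by ring) (by ring)
    · exact left u s t v (by ring) (by ring) (by ring) (by ring)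
    · exact left v s t u (by ring) (by ring) (by ring) (by ring)
    · exact right s t u v (by ring) (by ring) (by ring) (by ring)
    · exact right s u t v (by ring) (by ring) (by ring) (by ring)
    · exact right s v t u (by ring) (by ring) (by ring) (by ring)
    · exact right t u s v (by ring) (by ring) (by ring) (by ring)
    · exact right t v s u (by ring) (by ring) (by ring) (by ring)
    · exact right u v s t (by ring) (by ring) (by ring) (by ring)
  obtain ⟨S, hS, hroot⟩ :=
    (pairMatrix_isHermitian 0 s t u v).exists_finset_roots_of_krylov
      (pairMatrix_mulVec_pairVec 0 s t u v)
      (pairVec_independent hs.symm ht.symm hu.symm hv.symm hst hsu hsv htu htv huv) hrel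
  refine ⟨S, hS, fun x hx ↦ ?_⟩
  have h := hroot x hx
  rw [hsum] at h
  linear_combination h

end

theorem stmt_4 (s t u v : ℝ) (hst : s ≠ t) (hsu : s ≠ u) (hsv : s ≠ v)
    (htu : t ≠ u) (htv : t ≠ v) (huv : u ≠ v)
    (e1 e2 e3 e4 : ℝ)
    (he1 : e1 = s + t + u + v)
    (he2 : e2 = s * t + s * u + s * v + t * u + t * v + u * v)
    (he3 : e3 = s * t * u + s * t * v + s * u * v + t * u * v)
    (he4 : e4 = s * t * u * v)
    (g : ℝ → ℝ)
    (hg : ∀ x, g x = x ^ 5 - 4 * e1 * x ^ 4 + (4 * e1 ^ 2 + 6 * e2) * x ^ 3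
      - (12 * e1 * e2 + 4 * e3) * x ^ 2 + (9 * e2 ^ 2 + 8 * e1 * e3 - 4 * e4) * x
      - (12 * e2 * e3 - 8 * e1 * e4)) :
    ∃ S : Finset ℝ, S.card = 5 ∧ ∀ x ∈ S, g x = 0 := by
  have hzero {x y z : ℝ} (ht : x ≠ 0) (hu : y ≠ 0) (hv : z ≠ 0) (htu : x ≠ y)
      (htv : x ≠ z) (huv : y ≠ z) (h1 : e1 = x + y + z)
      (h2 : e2 = x * y + x * z + y * z) (h3 : e3 = x * y * z) (h4 : e4 = 0) :
      ∃ S : Finset ℝ, S.card = 5 ∧ ∀ x ∈ S, g x = 0 := by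
    obtain ⟨S, hS, hroot⟩ := exists_five_roots_of_zero ht hu hv htu htv huv
    refine ⟨S, hS, fun x hx ↦ ?_⟩
    rw [hg, h1, h2, h3, h4]
    linear_combination hroot x hx
  by_cases hs : s = 0
  · subst hs
    exact hzero hst.symm hsu.symm hsv.symm htu htv huv (by rw [he1]; ring) (by rw [he2]; ring)
      (by rw [he3]; ring) (by rw [he4]; ring)
  by_cases ht : t = 0
  · subst ht
    exact hzero hst htu.symm htv.symm hsu hsv huv (by rw [he1]; ring) (by rw [he2]; ring)
      (by rw [he3]; ring) (by rw [he4]; ring)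
  by_cases hu : u = 0
  · subst hu
    exact hzero hsu htu huv.symm hst hsv htv (by rw [he1]; ring) (by rw [he2]; ring)
      (by rw [he3]; ring) (by rw [he4]; ring)
  by_cases hv : v = 0
  · subst hv
    exact hzero hsv htv huv hst hsu htu (by rw [he1]; ring) (by rw [he2]; ring)
      (by rw [he3]; ring) (by rw [he4]; ring)
  simp only [hg]
  exact exists_five_roots_of_ne_zero hs ht hu hv hst hsu hsv htu htv huv e1 e2 e3 e4
    he1 he2 he3 he4
end

section
/- Let n ≥ 1, let c, d > 0 be real numbers, and let p₁ < q₁ < p₂ < q₂ < ⋯ < pₙ < qₙ be real numbers. Then the polynomial R(x) = c·∏_{i=1}^{n}(x − p_i) + d·∏_{i=1}^{n}(x − q_i) has n distinct real roots r₁, …, rₙ satisfying p_i < r_i < q_i for each i = 1, …, n. -/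
/-- A continuous real function whose values at `a < b` have opposite signs vanishes in between. -/
theorem exists_zero_of_mul_neg {f : ℝ → ℝ} (hf : Continuous f) {a b : ℝ} (hab : a < b)
    (h : f a * f b < 0) : ∃ x, a < x ∧ x < b ∧ f x = 0 := by
  have h0 : (0 : ℝ) ∈ Set.uIcc (f a) (f b) := by
    rw [Set.mem_uIcc]
    rcases mul_neg_iff.mp h with ⟨h1, h2⟩ | ⟨h1, h2⟩
    · exact Or.inr ⟨h2.le, h1.le⟩
    · exact Or.inl ⟨h1.le, h2.le⟩
  obtain ⟨x, hx, hx0⟩ := intermediate_value_uIcc hf.continuousOn h0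
  rw [Set.uIcc_of_le hab.le] at hx
  refine ⟨x, lt_of_le_of_ne hx.1 ?_, lt_of_le_of_ne hx.2 ?_, hx0⟩
  · rintro rfl
    simp [hx0] at h
  · rintro rfl
    simp [hx0] at h

/-- Consecutive separation of intervals `(p i, q i)` implies separation of all of them. -/
theorem lt_of_consecutive_lt {n : ℕ} {p q : Fin n → ℝ} (hpq : ∀ i, p i < q i)
    (hqp : ∀ i j : Fin n, (i : ℕ) + 1 = (j : ℕ) → q i < p j) {i j : Fin n} (hij : i < j) :
    q i < p j := by
  obtain ⟨j, hj⟩ := j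
  induction j with
  | zero => exact absurd hij (Nat.not_lt_zero _)
  | succ k ih =>
    have hik : (i : ℕ) ≤ k := Nat.lt_succ_iff.mp hij
    have hk : k < n := by omega
    rcases hik.eq_or_lt with h | h
    · exact hqp i ⟨k + 1, hj⟩ (by simp [h])
    · exact ((ih hk h).trans (hpq ⟨k, hk⟩)).trans (hqp ⟨k, hk⟩ ⟨k + 1, hj⟩ rfl)

/-- For separated intervals, the cross product of differences at the endpoints of any one of
them is negative. -/
theorem prod_cross_sub_neg {n : ℕ} {p q : Fin n → ℝ} (hpq : ∀ i, p i < q i)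
    (hsep : ∀ i j, i < j → q i < p j) (i : Fin n) :
    ∏ j, (p i - q j) * (q i - p j) < 0 := by
  rw [← Finset.mul_prod_erase _ _ (Finset.mem_univ i)]
  refine mul_neg_of_neg_of_pos
    (mul_neg_of_neg_of_pos (sub_neg.mpr (hpq i)) (sub_pos.mpr (hpq i))) ?_
  refine Finset.prod_pos fun j hj => ?_
  have hi := hpq i
  have hj' := hpq j
  rcases lt_or_gt_of_ne (Finset.ne_of_mem_erase hj) with h | h
  · have := hsep j i h
    exact mul_pos (by linarith) (by linarith)
  · have := hsep i j h
    exact mul_pos_of_neg_of_neg (by linarith) (by linarith)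

theorem stmt_6 (n : ℕ) (hn : 1 ≤ n) (c d : ℝ) (hc : 0 < c) (hd : 0 < d)
    (p q : Fin n → ℝ)
    (hpq : ∀ i, p i < q i)
    (hqp : ∀ i j : Fin n, (i : ℕ) + 1 = (j : ℕ) → q i < p j)
    (R : ℝ → ℝ)
    (hR : ∀ x, R x = c * ∏ i, (x - p i) + d * ∏ i, (x - q i)) :
    ∃ r : Fin n → ℝ, StrictMono r ∧ ∀ i, p i < r i ∧ r i < q i ∧ R (r i) = 0 := by
  have hsep : ∀ i j, i < j → q i < p j := fun _ _ => lt_of_consecutive_lt hpq hqp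
  have hcont : Continuous R := by
    rw [funext hR]
    fun_prop
  have hsign : ∀ i, R (p i) * R (q i) < 0 := fun i => by
    have hp : ∏ j, (p i - p j) = 0 := Finset.prod_eq_zero (Finset.mem_univ i) (sub_self _)
    have hq : ∏ j, (q i - q j) = 0 := Finset.prod_eq_zero (Finset.mem_univ i) (sub_self _)
    have hneg := mul_neg_of_pos_of_neg (mul_pos hc hd) (prod_cross_sub_neg hpq hsep i)
    rw [Finset.prod_mul_distrib] at hneg
    rw [hR, hR, hp, hq]
    linarith
  choose r hr using fun i => exists_zero_of_mul_neg hcont (hpq i) (hsign i)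
  exact ⟨r, fun i j hij => ((hr i).2.1.trans (hsep i j hij)).trans (hr j).1, hr⟩
end

section
/- For an integer m ≥ 1 and real numbers s₁, …, s_m, define P_m(s₁, …, s_m; x) = Σ_{i=0}^{m} (−1)^i (m − i + 1) x^{m−i} e_i(s₁, …, s_m), where e_i denotes the i-th elementary symmetric polynomial. Then for every m ≥ 2 one has the identity P_m(s₁, …, s_m; x) = (x − s_m)·P_{m−1}(s₁, …, s_{m−1}; x) + x·∏_{i=1}^{m−1}(x − s_i). -/
/-- The `i`-th elementary symmetric polynomial of `s 0, …, s (m-1)`. -/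
noncomputable def esymmOf (m i : ℕ) (s : ℕ → ℝ) : ℝ :=
  ∑ A ∈ Finset.powersetCard i (Finset.range m), ∏ j ∈ A, s j

/-- `P_m(s₁, …, s_m; x) = Σ_{i=0}^{m} (−1)^i (m − i + 1) x^{m−i} e_i(s₁, …, s_m)`,
where `s₁, …, s_m` are `s 0, …, s (m-1)`. -/
noncomputable def Pm (m : ℕ) (s : ℕ → ℝ) (x : ℝ) : ℝ :=
  ∑ i ∈ Finset.range (m + 1),
    (-1 : ℝ) ^ i * ((m - i + 1 : ℕ) : ℝ) * x ^ (m - i) * esymmOf m i s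

open Polynomial in
/-- Vieta's formula for `∏ (X - s j)`, in terms of `esymmOf`. -/
theorem prod_X_sub_C_eq_sum_esymmOf (m : ℕ) (s : ℕ → ℝ) :
    ∏ j ∈ Finset.range m, (X - C (s j)) =
      ∑ i ∈ Finset.range (m + 1), (-1) ^ i * (C (esymmOf m i s) * X ^ (m - i)) := by
  have h := Multiset.prod_X_sub_X_eq_sum_esymm ((Finset.range m).val.map s)
  simp only [Multiset.map_map, Function.comp_def, Multiset.card_map, Finset.card_val,
    Finset.card_range, Finset.esymm_map_val] at h
  exact h

open Polynomial in
/-- `P_m` is the derivative of `x ∏ (x - s j)`. -/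
theorem Pm_eq_eval_derivative (m : ℕ) (s : ℕ → ℝ) (x : ℝ) :
    Pm m s x = (derivative (X * ∏ j ∈ Finset.range m, (X - C (s j)))).eval x := by
  rw [prod_X_sub_C_eq_sum_esymmOf, Finset.mul_sum, derivative_sum, eval_finsetSum, Pm]
  refine Finset.sum_congr rfl fun i _ => ?_
  have h : (X : ℝ[X]) * ((-1) ^ i * (C (esymmOf m i s) * X ^ (m - i))) =
      C ((-1) ^ i * esymmOf m i s) * X ^ (m - i + 1) := by
    simp only [map_mul, map_pow, map_neg, map_one]
    ring
  rw [h, derivative_C_mul_X_pow, eval_C_mul, eval_pow, eval_X, Nat.add_sub_cancel]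
  ring

theorem stmt_7 (m : ℕ) (hm : 2 ≤ m) (s : ℕ → ℝ) (x : ℝ) :
    Pm m s x = (x - s (m - 1)) * Pm (m - 1) s x
      + x * ∏ i ∈ Finset.range (m - 1), (x - s i) := by
  obtain ⟨n, rfl⟩ : ∃ n, m = n + 1 := ⟨m - 1, by omega⟩
  rw [Nat.add_sub_cancel, Pm_eq_eval_derivative, Pm_eq_eval_derivative, Finset.prod_range_succ,
    ← mul_assoc, Polynomial.derivative_mul (g := Polynomial.X - Polynomial.C (s n))]
  simp only [Polynomial.derivative_X_sub_C, mul_one, Polynomial.eval_add, Polynomial.eval_mul,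
    Polynomial.eval_sub, Polynomial.eval_X, Polynomial.eval_C, Polynomial.eval_prod]
  ring
end

section
/- For an integer m ≥ 1 and real numbers 0 < s₁ < s₂ < ⋯ < s_m, the degree-m polynomial P_m(s₁, …, s_m; x) = Σ_{i=0}^{m} (−1)^i (m − i + 1) x^{m−i} e_i(s₁, …, s_m) has m distinct real roots r₁, …, r_m satisfying 0 < r₁ < s₁ < r₂ < s₂ < ⋯ < r_m < s_m. -/
open Finset in
theorem prod_range_sub_eq_sum_esymmOf (m : ℕ) (s : ℕ → ℝ) (x : ℝ) :
    ∏ j ∈ range m, (x - s j) =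
      ∑ i ∈ range (m + 1), (-1 : ℝ) ^ i * x ^ (m - i) * esymmOf m i s := by
  have h : ∏ j ∈ range m, (x - s j) = ∏ j ∈ range m, (-s j + x) :=
    prod_congr rfl fun j _ => by ring
  rw [h, prod_add, sum_powerset, card_range]
  refine sum_congr rfl fun i _ => ?_
  rw [esymmOf, mul_sum]
  refine sum_congr rfl fun A hA => ?_
  obtain ⟨hsub, hcard⟩ := mem_powersetCard.mp hA
  rw [prod_neg, prod_const, card_sdiff_of_subset hsub, card_range, hcard]
  ring

open Finset in
/-- `Pm m s` is the derivative of `x ↦ x * ∏ (x - s j)`. -/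
theorem hasDerivAt_mul_prod_range_sub (m : ℕ) (s : ℕ → ℝ) (x : ℝ) :
    HasDerivAt (fun y : ℝ => y * ∏ j ∈ range m, (y - s j)) (Pm m s x) x := by
  have h : (fun y : ℝ => y * ∏ j ∈ range m, (y - s j)) = fun y =>
      ∑ i ∈ range (m + 1), (-1 : ℝ) ^ i * y ^ (m - i + 1) * esymmOf m i s := by
    funext y
    rw [prod_range_sub_eq_sum_esymmOf, mul_sum]
    exact sum_congr rfl fun i _ => by ring
  rw [h]
  refine HasDerivAt.fun_sum fun i _ => ?_
  refine (((hasDerivAt_pow (m - i + 1) x).const_mul ((-1 : ℝ) ^ i)).mul_const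
    (esymmOf m i s)).congr_deriv ?_
  rw [Nat.add_sub_cancel]
  ring

/-- Rolle's theorem for `x ↦ x * ∏ (x - s j)` between two of its roots. -/
theorem exists_Pm_eq_zero_of_roots (m : ℕ) (s : ℕ → ℝ) {a b : ℝ} (hab : a < b)
    (ha : a * ∏ j ∈ Finset.range m, (a - s j) = 0)
    (hb : b * ∏ j ∈ Finset.range m, (b - s j) = 0) :
    ∃ c, a < c ∧ c < b ∧ Pm m s c = 0 := by
  obtain ⟨c, hc, hc0⟩ := exists_hasDerivAt_eq_zero hab
    (fun x _ => (hasDerivAt_mul_prod_range_sub m s x).continuousAt.continuousWithinAt)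
    (ha.trans hb.symm) (fun x _ => hasDerivAt_mul_prod_range_sub m s x)
  exact ⟨c, hc.1, hc.2, hc0⟩

theorem stmt_8 (m : ℕ) (hm : 1 ≤ m) (s : ℕ → ℝ)
    (h0 : 0 < s 0) (hmono : ∀ i, i + 1 < m → s i < s (i + 1)) :
    ∃ r : ℕ → ℝ,
      (∀ i < m, Pm m s (r i) = 0) ∧
      0 < r 0 ∧
      (∀ i < m, r i < s i) ∧
      (∀ i, i + 1 < m → s i < r (i + 1)) := by
  have hroot : ∀ i < m, s i * ∏ j ∈ Finset.range m, (s i - s j) = 0 := fun i hi => by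
    rw [Finset.prod_eq_zero (Finset.mem_range.mpr hi) (sub_self _), mul_zero]
  obtain ⟨c, hc_pos, hc_lt, hc_zero⟩ :=
    exists_Pm_eq_zero_of_roots m s h0 (zero_mul _) (hroot 0 hm)
  have hstep : ∀ i, ∃ d, i + 1 < m → s i < d ∧ d < s (i + 1) ∧ Pm m s d = 0 := fun i => by
    by_cases hi : i + 1 < m
    · obtain ⟨d, hd⟩ := exists_Pm_eq_zero_of_roots m s (hmono i hi)
        (hroot i (by lia)) (hroot (i + 1) hi)
      exact ⟨d, fun _ => hd⟩
    · exact ⟨0, fun h => absurd h hi⟩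
  choose d hd using hstep
  refine ⟨fun i => Nat.casesOn i c d, ?_, hc_pos, ?_, fun i hi => (hd i hi).1⟩
  · rintro (_ | i) hi
    exacts [hc_zero, (hd i hi).2.2]
  · rintro (_ | i) hi
    exacts [hc_lt, (hd i hi).2.1]
end

section
/- Let m ≥ 1, let s₁, …, s_m be real numbers, and fix i with 0 ≤ i ≤ m. Consider the m×m matrix B_i whose rows are indexed by the elements k of {0, 1, …, m} \ {i} taken in increasing order, whose columns are indexed by j = 1, …, m, and whose (k, j) entry is s_j^{m+1−k}. Then det(B_i) = e_i(s₁, …, s_m) · (s₁s₂⋯s_m) · ∏_{j<k}(s_j − s_k), where e_i denotes the i-th elementary symmetric polynomial. -/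
open Finset Polynomial Matrix in
/-- Deleting the column of index `i` from the `m × (m + 1)` Vandermonde matrix with decreasing
exponents multiplies the Vandermonde product by the `i`-th elementary symmetric polynomial. -/
theorem det_rectVandermonde_submatrix_succAbove {R : Type*} [CommRing R] {m : ℕ}
    (s : Fin m → R) (i : Fin (m + 1)) :
    ((rectVandermonde 1 s (m + 1)).submatrix id i.succAbove).det =
      (∑ A ∈ powersetCard (i : ℕ) univ, ∏ j ∈ A, s j) * ∏ j, ∏ k ∈ Ioi j, (s j - s k) := by
  have hi : (i : ℕ) ≤ m := Nat.lt_succ_iff.mp i.isLt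
  have expand := det_succ_row_zero
    (projVandermonde 1 (Fin.cons X (fun j => C (s j)) : Fin (m + 1) → R[X]))
  have minor (k : Fin (m + 1)) :
      ((projVandermonde 1 (Fin.cons X (fun j => C (s j)) : Fin (m + 1) → R[X])).submatrix
        Fin.succ k.succAbove).det =
      C ((rectVandermonde 1 s (m + 1)).submatrix id k.succAbove).det := by
    rw [RingHom.map_det]
    congr 1
    ext1 a b
    simp [projVandermonde_apply, rectVandermonde_apply]
  have vieta : (∏ j, (X - C (s j))).coeff (m - i) =
      (-1) ^ (i : ℕ) * ∑ A ∈ powersetCard (i : ℕ) univ, ∏ j ∈ A, s j := by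
    have h := Multiset.prod_X_sub_C_coeff (univ.val.map s) (k := m - i) (by simp)
    rw [Multiset.map_map, Multiset.card_map, Finset.esymm_map_val, card_val, card_univ,
      Fintype.card_fin, Nat.sub_sub_self hi] at h
    exact h
  simp only [minor, det_projVandermonde, Fin.prod_univ_succ, projVandermonde_apply] at expand
  simp only [Fin.prod_Ioi_zero, Fin.prod_Ioi_succ, Fin.cons_zero, Fin.cons_succ, Pi.one_apply,
    one_mul, one_pow, ← C_sub, ← map_prod] at expand
  have coeff_eq := congrArg (coeff · (m - i)) expand
  simp only [coeff_mul_C, vieta, finsetSum_coeff] at coeff_eq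
  rw [sum_eq_single i] at coeff_eq
  · have hx : ((-1 : R[X]) ^ (i : ℕ) * X ^ (Fin.rev i : ℕ)).coeff (m - i) = (-1) ^ (i : ℕ) := by
      rw [show (-1 : R[X]) = C (-1) by simp, ← C_pow, coeff_C_mul_X_pow, if_pos]
      simp [Fin.val_rev]
    rw [hx, mul_assoc] at coeff_eq
    exact ((isUnit_neg_one.pow _).mul_left_cancel coeff_eq).symm
  · intro k _ hk
    rw [show (-1 : R[X]) = C (-1) by simp, ← C_pow, coeff_C_mul_X_pow, if_neg, zero_mul]
    rw [Fin.val_rev]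
    have := Fin.val_ne_of_ne hk
    omega
  · simp

theorem stmt_9 (m : ℕ) (hm : 1 ≤ m) (s : Fin m → ℝ) (i : ℕ) (hi : i ≤ m)
    (B : Matrix (Fin m) (Fin m) ℝ)
    (hB : ∀ k j, B k j = s j ^ (m + 1 - (if (k : ℕ) < i then (k : ℕ) else (k : ℕ) + 1))) :
    B.det = (∑ A ∈ Finset.powersetCard i (Finset.univ : Finset (Fin m)), ∏ j ∈ A, s j)
      * (∏ j, s j)
      * ∏ p ∈ Finset.univ.filter (fun p : Fin m × Fin m => p.1 < p.2), (s p.1 - s p.2) := by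
  have hprod : ∏ p ∈ Finset.univ.filter (fun p : Fin m × Fin m => p.1 < p.2), (s p.1 - s p.2) =
      ∏ j, ∏ k ∈ Finset.Ioi j, (s j - s k) := by
    rw [Finset.prod_filter, Fintype.prod_prod_type]
    refine Finset.prod_congr rfl fun j _ => ?_
    rw [← Finset.prod_filter]
    exact Finset.prod_congr (by ext; simp) fun _ _ => rfl
  let i' : Fin (m + 1) := ⟨i, Nat.lt_succ_of_le hi⟩
  have hfactor : B.transpose = Matrix.of fun j k =>
      s j * ((Matrix.rectVandermonde 1 s (m + 1)).submatrix id i'.succAbove) j k := by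
    ext j k
    have hk := k.isLt
    simp only [Matrix.transpose_apply, hB, Matrix.of_apply, Matrix.submatrix_apply, id_eq,
      Matrix.rectVandermonde_apply, Pi.one_apply, one_pow, one_mul, ← pow_succ', Fin.val_rev]
    congr 1
    simp only [Fin.succAbove, Fin.lt_def, i', Fin.val_castSucc]
    split_ifs <;> simp only [Fin.val_castSucc, Fin.val_succ] <;> omega
  rw [← Matrix.det_transpose, hfactor, Matrix.det_mul_column,
    det_rectVandermonde_submatrix_succAbove, hprod]
  ring
end

section
/- Let s and t be real numbers with s ≠ t. Then the cubic polynomial 25x³ − 25(s + t)x² + (19st + 6s² + 6t²)x − 3(s²t + st²) has three distinct real roots. -/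
/-- A continuous real function with alternating signs at four increasing points has three
distinct zeros. -/
lemma exists_three_zeros_of_sign_changes {f : ℝ → ℝ} (hf : Continuous f) {a b c d : ℝ}
    (hab : a < b) (hbc : b < c) (hcd : c < d)
    (ha : f a < 0) (hb : 0 < f b) (hc : f c < 0) (hd : 0 < f d) :
    ∃ r1 r2 r3 : ℝ, r1 ≠ r2 ∧ r1 ≠ r3 ∧ r2 ≠ r3 ∧
      ∀ x ∈ ({r1, r2, r3} : Set ℝ), f x = 0 := by
  obtain ⟨r1, h1, e1⟩ := intermediate_value_Ioo hab.le hf.continuousOn ⟨ha, hb⟩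
  obtain ⟨r2, h2, e2⟩ := intermediate_value_Ioo' hbc.le hf.continuousOn ⟨hc, hb⟩
  obtain ⟨r3, h3, e3⟩ := intermediate_value_Ioo hcd.le hf.continuousOn ⟨hc, hd⟩
  refine ⟨r1, r2, r3, (h1.2.trans h2.1).ne, (h1.2.trans (hbc.trans h3.1)).ne,
    (h2.2.trans h3.1).ne, ?_⟩
  rintro x (rfl | rfl | rfl) <;> assumption

/-- The cubic is positive at `2 * m` whenever `|s + t| ≤ m` and `4 * |s * t| ≤ m ^ 2`. -/
lemma cubic_pos_of_bounds {s t m : ℝ} (hm : 0 < m) (hp : |s + t| ≤ m)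
    (hq : 4 * |s * t| ≤ m ^ 2) :
    0 < 25 * (2 * m) ^ 3 - 25 * (s + t) * (2 * m) ^ 2
      + (19 * s * t + 6 * s ^ 2 + 6 * t ^ 2) * (2 * m) - 3 * (s ^ 2 * t + s * t ^ 2) := by
  have hpq : |s + t| * |s * t| ≤ m * (m ^ 2 / 4) :=
    mul_le_mul hp (by linarith) (abs_nonneg _) hm.le
  rw [← abs_mul] at hpq
  have h1 := (abs_le.mp hpq).2
  have h2 : (s + t) * m ^ 2 ≤ m * m ^ 2 :=
    mul_le_mul_of_nonneg_right (abs_le.mp hp).2 (sq_nonneg m)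
  have h3 : -(m ^ 2 / 4) * m ≤ s * t * m :=
    mul_le_mul_of_nonneg_right (by linarith [neg_abs_le (s * t)]) hm.le
  have h4 : 0 ≤ (s + t) ^ 2 * m := by positivity
  have h5 : 0 < m ^ 3 := by positivity
  nlinarith

/-- The two inner points at which the cubic has signs opposite to its signs at infinity. -/
lemma exists_inner_sign_change {s t : ℝ} (hst : s ≠ t) :
    ∃ a b : ℝ, a < b ∧ |a| ≤ |s| + |t| ∧ |b| ≤ |s| + |t| ∧
      0 < 25 * a ^ 3 - 25 * (s + t) * a ^ 2 + (19 * s * t + 6 * s ^ 2 + 6 * t ^ 2) * a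
          - 3 * (s ^ 2 * t + s * t ^ 2) ∧
      25 * b ^ 3 - 25 * (s + t) * b ^ 2 + (19 * s * t + 6 * s ^ 2 + 6 * t ^ 2) * b
          - 3 * (s ^ 2 * t + s * t ^ 2) < 0 := by
  have hp := abs_le.mp (abs_add_le s t)
  have hm : 0 ≤ |s| + |t| := by positivity
  rcases lt_trichotomy (s + t) 0 with h | h | h
  · have h3 : 0 < (-(s + t)) ^ 3 := pow_pos (by linarith) 3
    have h4 : 0 ≤ -(s + t) * (s - t) ^ 2 := mul_nonneg (by linarith) (sq_nonneg _)
    refine ⟨3 * (s + t) / 7, (s + t) / 4, by linarith, abs_le.mpr ⟨by linarith, by linarith⟩,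
      abs_le.mpr ⟨by linarith, by linarith⟩, by nlinarith, by nlinarith⟩
  · obtain rfl : t = -s := by linarith
    have hs : s ≠ 0 := by rintro rfl; simp at hst
    have h3 : 0 < |s| ^ 3 := by positivity
    have h4 : s ^ 2 = |s| ^ 2 := (sq_abs s).symm
    have key : ∀ x : ℝ, 25 * x ^ 3 - 25 * (s + -s) * x ^ 2
        + (19 * s * -s + 6 * s ^ 2 + 6 * (-s) ^ 2) * x - 3 * (s ^ 2 * -s + s * (-s) ^ 2)
        = 25 * x ^ 3 - 7 * |s| ^ 2 * x := fun x => by rw [← h4]; ring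
    have h0 : 0 < |s| := abs_pos.mpr hs
    refine ⟨-(|s| / 2), |s| / 2, by linarith, ?_, ?_, ?_, ?_⟩
    · rw [abs_neg, abs_neg, abs_of_pos (by linarith)]; linarith
    · rw [abs_neg, abs_of_pos (by linarith)]; linarith
    · rw [key]; nlinarith
    · rw [key]; nlinarith
  · have h3 : 0 < (s + t) ^ 3 := pow_pos h 3
    have h4 : 0 ≤ (s + t) * (s - t) ^ 2 := mul_nonneg h.le (sq_nonneg _)
    refine ⟨(s + t) / 4, 3 * (s + t) / 7, by linarith, abs_le.mpr ⟨by linarith, by linarith⟩,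
      abs_le.mpr ⟨by linarith, by linarith⟩, by nlinarith, by nlinarith⟩

theorem stmt_10 (s t : ℝ) (hst : s ≠ t) :
    ∃ r1 r2 r3 : ℝ, r1 ≠ r2 ∧ r1 ≠ r3 ∧ r2 ≠ r3 ∧
      (∀ x ∈ ({r1, r2, r3} : Set ℝ),
        25 * x ^ 3 - 25 * (s + t) * x ^ 2 + (19 * s * t + 6 * s ^ 2 + 6 * t ^ 2) * x
          - 3 * (s ^ 2 * t + s * t ^ 2) = 0) := by
  obtain ⟨a, b, hab, ha, hb, hfa, hfb⟩ := exists_inner_sign_change hst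
  have hm : 0 < |s| + |t| := by
    have := abs_pos.mpr (sub_ne_zero.mpr hst)
    linarith [abs_sub s t]
  have hq : 4 * |s * t| ≤ (|s| + |t|) ^ 2 := by
    rw [abs_mul]; nlinarith [sq_nonneg (|s| - |t|)]
  have hright := cubic_pos_of_bounds hm (abs_add_le s t) hq
  have hleft := cubic_pos_of_bounds (s := -s) (t := -t) hm
    (by rw [← neg_add, abs_neg]; exact abs_add_le s t) (by rwa [neg_mul_neg])
  rw [abs_le] at ha hb
  exact exists_three_zeros_of_sign_changes
    (f := fun x => 25 * x ^ 3 - 25 * (s + t) * x ^ 2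
      + (19 * s * t + 6 * s ^ 2 + 6 * t ^ 2) * x - 3 * (s ^ 2 * t + s * t ^ 2))
    (by fun_prop) (a := -(2 * (|s| + |t|))) (b := a) (c := b) (d := 2 * (|s| + |t|))
    (by linarith) hab (by linarith) (by linarith) hfa hfb hright
end

section
/- Let s, t, u be distinct nonzero real numbers and set e₁ = t + u and e₂ = tu. Then the cubic polynomial g(x) = (x − 2e₁)(x² − 2e₁x + 3e₂) − s(3x² − 10e₁x + 8e₁² + e₂), i.e. g(x) = x³ − (3s + 4e₁)x² + (4e₁² + 3e₂ + 10se₁)x − (6e₁e₂ + 8se₁² + se₂), has three distinct real roots. -/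
/-- A monic real cubic is positive at some positive point. -/
lemma exists_pos_monic_cubic_pos (a b c : ℝ) :
    ∃ k : ℝ, 0 < k ∧ 0 < k ^ 3 + a * k ^ 2 + b * k + c := by
  refine ⟨1 + |a| + |b| + |c|, by positivity, ?_⟩
  set k := 1 + |a| + |b| + |c| with hk
  have ha := abs_nonneg a
  have hb := abs_nonneg b
  have hc := abs_nonneg c
  have hk1 : 1 ≤ k := by linarith
  have hk2 : k ≤ k ^ 2 := by nlinarith
  have h1 : -|a| * k ^ 2 ≤ a * k ^ 2 :=
    mul_le_mul_of_nonneg_right (neg_abs_le a) (by positivity)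
  have h2 : -|b| * k ≤ b * k := mul_le_mul_of_nonneg_right (neg_abs_le b) (by linarith)
  have h3 : |b| * k ≤ |b| * k ^ 2 := mul_le_mul_of_nonneg_left hk2 hb
  have h4 : |c| * 1 ≤ |c| * k ^ 2 := mul_le_mul_of_nonneg_left (hk1.trans hk2) hc
  have h5 : k ^ 3 = k ^ 2 + |a| * k ^ 2 + |b| * k ^ 2 + |c| * k ^ 2 := by
    calc k ^ 3 = k * k ^ 2 := by ring
      _ = (1 + |a| + |b| + |c|) * k ^ 2 := by rw [← hk]
      _ = _ := by ring
  linarith [neg_abs_le c]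

/-- A monic real cubic which is positive at `p` and negative at some `q > p` has three distinct
real roots. -/
lemma exists_three_roots_of_monic_cubic {a b c p q : ℝ} {g : ℝ → ℝ}
    (hg : ∀ x, g x = x ^ 3 + a * x ^ 2 + b * x + c) (hpq : p < q) (hp : 0 < g p) (hq : g q < 0) :
    ∃ r1 r2 r3 : ℝ, r1 < r2 ∧ r2 < r3 ∧ g r1 = 0 ∧ g r2 = 0 ∧ g r3 = 0 := by
  have hcont : Continuous g := by
    rw [funext hg]
    fun_prop
  obtain ⟨k, hk, hgk⟩ :=
    exists_pos_monic_cubic_pos (3 * q + a) (3 * q ^ 2 + 2 * a * q + b) (g q)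
  obtain ⟨l, hl, hgl⟩ :=
    exists_pos_monic_cubic_pos (-(3 * p + a)) (3 * p ^ 2 + 2 * a * p + b) (-g p)
  have hright : 0 < g (q + k) := by
    rw [hg] at hgk ⊢
    linarith
  have hleft : g (p - l) < 0 := by
    rw [hg] at hgl ⊢
    linarith
  obtain ⟨r1, h1, hr1⟩ := intermediate_value_Ioo (sub_le_self p hl.le) hcont.continuousOn
    ⟨hleft, hp⟩
  obtain ⟨r2, h2, hr2⟩ := intermediate_value_Ioo' hpq.le hcont.continuousOn ⟨hq, hp⟩
  obtain ⟨r3, h3, hr3⟩ := intermediate_value_Ioo (le_add_of_nonneg_right hk.le)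
    hcont.continuousOn ⟨hq, hright⟩
  exact ⟨r1, r2, r3, h1.2.trans h2.1, h2.2.trans h3.1, hr1, hr2, hr3⟩

theorem stmt_11 (s t u : ℝ) (hs : s ≠ 0) (ht : t ≠ 0) (hu : u ≠ 0)
    (hst : s ≠ t) (hsu : s ≠ u) (htu : t ≠ u)
    (e1 e2 : ℝ) (he1 : e1 = t + u) (he2 : e2 = t * u)
    (g : ℝ → ℝ)
    (hg : ∀ x, g x = (x - 2 * e1) * (x ^ 2 - 2 * e1 * x + 3 * e2)
      - s * (3 * x ^ 2 - 10 * e1 * x + 8 * e1 ^ 2 + e2)) :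
    (∀ x, g x = x ^ 3 - (3 * s + 4 * e1) * x ^ 2
      + (4 * e1 ^ 2 + 3 * e2 + 10 * s * e1) * x
      - (6 * e1 * e2 + 8 * s * e1 ^ 2 + s * e2)) ∧
    ∃ r1 r2 r3 : ℝ, r1 ≠ r2 ∧ r1 ≠ r3 ∧ r2 ≠ r3 ∧
      g r1 = 0 ∧ g r2 = 0 ∧ g r3 = 0 := by
  refine ⟨fun x => by rw [hg]; ring, ?_⟩
  have he2_ne : e2 ≠ 0 := he2 ▸ mul_ne_zero ht hu
  have hdisc : 0 < e1 ^ 2 - 4 * e2 := by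
    have := sq_pos_of_ne_zero (sub_ne_zero.mpr htu)
    rw [he1, he2]
    linarith
  have hw_arg : 0 < e1 ^ 2 - 3 * e2 := by nlinarith [sq_nonneg e1]
  -- The coefficient of `s` vanishes at `(5 * e1 ± w) / 3`, and there `g` has a sign free of `s`.
  obtain ⟨w, hw, hw2⟩ : ∃ w : ℝ, 0 < w ∧ w ^ 2 = e1 ^ 2 - 3 * e2 :=
    ⟨√(e1 ^ 2 - 3 * e2), Real.sqrt_pos.mpr hw_arg, Real.sq_sqrt hw_arg.le⟩
  have he2w : e2 = (e1 ^ 2 - w ^ 2) / 3 := by linarith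
  obtain ⟨hlow, hhigh⟩ : -(2 * w) < e1 ∧ e1 < 2 * w :=
    abs_lt_of_sq_lt_sq' (by linarith) (by linarith)
  have hminus : w - e1 ≠ 0 := fun h => he2_ne (by rw [he2w, sub_eq_zero.mp h]; ring)
  have hplus : w + e1 ≠ 0 := fun h => he2_ne (by rw [he2w, eq_neg_of_add_eq_zero_left h]; ring)
  have hp : 0 < g ((5 * e1 - w) / 3) := by
    have hval : g ((5 * e1 - w) / 3) = 4 / 27 * ((w + e1) ^ 2 * (2 * w - e1)) := by
      rw [hg, he2w]
      ring
    have := mul_pos (sq_pos_of_ne_zero hplus) (sub_pos.mpr hhigh)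
    linarith
  have hq : g ((5 * e1 + w) / 3) < 0 := by
    have hval : g ((5 * e1 + w) / 3) = -(4 / 27 * ((w - e1) ^ 2 * (e1 + 2 * w))) := by
      rw [hg, he2w]
      ring
    have := mul_pos (sq_pos_of_ne_zero hminus) (show 0 < e1 + 2 * w by linarith)
    linarith
  obtain ⟨r1, r2, r3, h12, h23, h1, h2, h3⟩ := exists_three_roots_of_monic_cubic
    (a := -(3 * s + 4 * e1)) (b := 4 * e1 ^ 2 + 3 * e2 + 10 * s * e1)
    (c := -(6 * e1 * e2 + 8 * s * e1 ^ 2 + s * e2)) (fun x => by rw [hg]; ring)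
    (by linarith) hp hq
  exact ⟨r1, r2, r3, h12.ne, (h12.trans h23).ne, h23.ne, h1, h2, h3⟩
end

section
/- For all real numbers s, t, u, letting e₁, e₂, e₃ denote the elementary symmetric polynomials of s, t, u, both of the following hold: (a) 4e₂²e₁² − 15e₃e₁³ − 15e₂³ + 63e₃e₂e₁ − 81e₃² ≥ 0, and (b) 256e₂²e₁² − 768e₃e₁³ − 768e₂³ + 2592e₃e₂e₁ − 2187e₃² ≥ 0. -/
/-- The discriminant of the monic cubic with roots `s`, `t`, `u`, written in the elementary
symmetric polynomials, is the square of the Vandermonde product. -/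
theorem cubic_discr_eq_sq {R : Type*} [CommRing R] (s t u : R) :
    (s + t + u) ^ 2 * (s * t + s * u + t * u) ^ 2 - 4 * (s * t + s * u + t * u) ^ 3
        - 4 * (s + t + u) ^ 3 * (s * t * u)
        + 18 * (s + t + u) * (s * t + s * u + t * u) * (s * t * u) - 27 * (s * t * u) ^ 2
      = ((s - t) * (s - u) * (t - u)) ^ 2 := by
  ring

theorem stmt_14 (s t u : ℝ)
    (e1 e2 e3 : ℝ) (he1 : e1 = s + t + u)
    (he2 : e2 = s * t + s * u + t * u) (he3 : e3 = s * t * u) :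
    0 ≤ 4 * e2 ^ 2 * e1 ^ 2 - 15 * e3 * e1 ^ 3 - 15 * e2 ^ 3
        + 63 * e3 * e2 * e1 - 81 * e3 ^ 2 ∧
    0 ≤ 256 * e2 ^ 2 * e1 ^ 2 - 768 * e3 * e1 ^ 3 - 768 * e2 ^ 3
        + 2592 * e3 * e2 * e1 - 2187 * e3 ^ 2 := by
  have discr_nonneg : 0 ≤ e1 ^ 2 * e2 ^ 2 - 4 * e2 ^ 3 - 4 * e1 ^ 3 * e3
      + 18 * e1 * e2 * e3 - 27 * e3 ^ 2 := by
    rw [he1, he2, he3, cubic_discr_eq_sq]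
    exact sq_nonneg _
  constructor
  · linarith [sq_nonneg (e1 * e2 - 9 * e3)]
  · linarith [sq_nonneg (4 * e1 * e2 - 27 * e3), sq_nonneg e3]
end

section
/- Let s and t be real numbers, not both zero. Then each of the four quadratic polynomials 36x² − (12t + 30s)x + (6st + 5s²), 36x² − (12s + 30t)x + (6st + 5t²), 3x² − 2(s + t)x + st, and 36x² − 30(s + t)x + (5t² + 14st + 5s²) has two distinct real roots. -/
/-- A real quadratic `a x² - b x + c` with positive discriminant has two distinct real roots. -/
theorem exists_ne_roots_of_discrim_pos {a b c : ℝ} (ha : a ≠ 0) (hd : 0 < b ^ 2 - 4 * a * c) :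
    ∃ x y : ℝ, x ≠ y ∧ a * x ^ 2 - b * x + c = 0 ∧ a * y ^ 2 - b * y + c = 0 := by
  have hr : 0 < √(b ^ 2 - 4 * a * c) := Real.sqrt_pos.mpr hd
  have hsq : √(b ^ 2 - 4 * a * c) ^ 2 = b ^ 2 - 4 * a * c := Real.sq_sqrt hd.le
  generalize √(b ^ 2 - 4 * a * c) = r at hr hsq
  refine ⟨(b + r) / (2 * a), (b - r) / (2 * a), fun h => ?_, ?_, ?_⟩
  · rw [div_left_inj' (by simpa using ha)] at h
    linarith
  · field_simp
    linear_combination hsq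
  · field_simp
    linear_combination hsq

theorem stmt_15 (s t : ℝ) (hst : ¬(s = 0 ∧ t = 0)) :
    (∃ x y : ℝ, x ≠ y ∧
      36 * x ^ 2 - (12 * t + 30 * s) * x + (6 * s * t + 5 * s ^ 2) = 0 ∧
      36 * y ^ 2 - (12 * t + 30 * s) * y + (6 * s * t + 5 * s ^ 2) = 0) ∧
    (∃ x y : ℝ, x ≠ y ∧
      36 * x ^ 2 - (12 * s + 30 * t) * x + (6 * s * t + 5 * t ^ 2) = 0 ∧
      36 * y ^ 2 - (12 * s + 30 * t) * y + (6 * s * t + 5 * t ^ 2) = 0) ∧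
    (∃ x y : ℝ, x ≠ y ∧
      3 * x ^ 2 - 2 * (s + t) * x + s * t = 0 ∧
      3 * y ^ 2 - 2 * (s + t) * y + s * t = 0) ∧
    (∃ x y : ℝ, x ≠ y ∧
      36 * x ^ 2 - 30 * (s + t) * x + (5 * t ^ 2 + 14 * s * t + 5 * s ^ 2) = 0 ∧
      36 * y ^ 2 - 30 * (s + t) * y + (5 * t ^ 2 + 14 * s * t + 5 * s ^ 2) = 0) := by
  have hs := sq_nonneg s
  have ht := sq_nonneg t
  have hsub := sq_nonneg (s - t)
  have hpos : 0 < s ^ 2 + t ^ 2 := by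
    by_contra! h
    exact hst ⟨pow_eq_zero_iff two_ne_zero |>.mp (by linarith),
      pow_eq_zero_iff two_ne_zero |>.mp (by linarith)⟩
  refine ⟨?_, ?_, ?_, ?_⟩ <;>
    exact exists_ne_roots_of_discrim_pos (by norm_num) (by nlinarith only [hs, ht, hsub, hpos])
end

section
/- Let n ≥ 1, let s > 0 be a real number, and let K(s) be the n×n matrix whose (i, j) entry is binom(j−1, i−1)·s^{j−i} for j ≥ i and 0 for j < i. Then for every 1 ≤ k ≤ n and all strictly increasing sequences of indices i₁ < i₂ < ⋯ < i_k and j₁ < j₂ < ⋯ < j_k in {1, …, n} satisfying i_l ≤ j_l for every l, the k×k minor det((K(s))_{i_a, j_b})_{1 ≤ a,b ≤ k} is strictly positive. -/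
/-- The matrix `K(s)` whose rows are the normalized derivatives of the rational
normal curve: its `(i, j)` entry (`0`-indexed) is `binom(j, i) · s^(j−i)` for `j ≥ i`
and `0` for `j < i`. -/
noncomputable def Kmat (n : ℕ) (s : ℝ) : Matrix (Fin n) (Fin n) ℝ :=
  fun i j =>
    if (i : ℕ) ≤ (j : ℕ)
    then (Nat.choose (j : ℕ) (i : ℕ) : ℝ) * s ^ ((j : ℕ) - (i : ℕ))
    else 0

/-- A minor of the Pascal matrix with a repeated row vanishes. -/
theorem det_choose_eq_zero_of_not_injective {k : ℕ} (r c : Fin k → ℕ)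
    (h : ¬ Function.Injective r) :
    (Matrix.of fun a b => (Nat.choose (c b) (r a) : ℝ)).det = 0 := by
  simp only [Function.Injective, not_forall] at h
  obtain ⟨a, b, hab, hne⟩ := h
  exact Matrix.det_zero_of_row_eq hne (by ext j; simp [hab])

/-- If `r` is monotone and `c` strictly monotone, the minor of the Pascal matrix `binom(c, r)` is
nonnegative, and it is positive when `r` is strictly monotone with `r ≤ c`. -/
theorem det_choose_nonneg_and_pos (k m : ℕ) (r c : Fin k → ℕ) (hr : Monotone r)
    (hc : StrictMono c) (hm : ∀ h : 0 < k, c ⟨0, h⟩ = m) :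
    0 ≤ (Matrix.of fun a b => (Nat.choose (c b) (r a) : ℝ)).det ∧
      (StrictMono r → (∀ a, r a ≤ c a) →
        0 < (Matrix.of fun a b => (Nat.choose (c b) (r a) : ℝ)).det) := by
  induction k generalizing m with
  | zero => simp
  | succ k ihk =>
    induction m generalizing r c with
    | zero =>
      have hc0 : c 0 = 0 := hm k.succ_pos
      by_cases hinj : Function.Injective r
      · have hrs : StrictMono r := hr.strictMono_of_injective hinj
        by_cases hr0 : r 0 = 0
        · have hminor : (Matrix.of fun a b => (Nat.choose (c b) (r a) : ℝ)).det =
              (Matrix.of fun a b : Fin k =>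
                (Nat.choose (c b.succ) (r a.succ) : ℝ)).det := by
            rw [Matrix.det_succ_column_zero, Fin.sum_univ_succ, Finset.sum_eq_zero]
            · simp [hc0, hr0, Matrix.submatrix]
            · intro a _
              have hpos : 0 < r a.succ := hr0 ▸ hrs a.succ_pos
              simp [hc0, Nat.choose_eq_zero_of_lt hpos]
          rw [hminor]
          have ih := ihk (if h : 0 < k then c (Fin.succ ⟨0, h⟩) else 0)
            (fun a => r a.succ) (fun a => c a.succ)
            (fun a b h => hr (Fin.succ_le_succ_iff.mpr h))
            (fun a b h => hc (Fin.succ_lt_succ_iff.mpr h)) (fun h => by simp [h])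
          exact ⟨ih.1, fun _ hle =>
            ih.2 (fun a b h => hrs (Fin.succ_lt_succ_iff.mpr h)) fun a => hle _⟩
        · refine ⟨(Matrix.det_eq_zero_of_column_eq_zero 0 fun a => ?_).ge, fun _ hle => ?_⟩
          · have hpos : 0 < r a :=
              (Nat.pos_of_ne_zero hr0).trans_le (hr (Fin.zero_le a))
            simp [hc0, Nat.choose_eq_zero_of_lt hpos]
          · have := hle 0
            omega
      · exact ⟨(det_choose_eq_zero_of_not_injective r c hinj).ge,
          fun hrs => absurd hrs.injective hinj⟩
    | succ m ihm =>
      by_cases hinj : Function.Injective r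
      swap
      · exact ⟨(det_choose_eq_zero_of_not_injective r c hinj).ge,
          fun hrs => absurd hrs.injective hinj⟩
      have hrs : StrictMono r := hr.strictMono_of_injective hinj
      have hcpos : ∀ b, 0 < c b := fun b => by
        have h0 : c 0 = m + 1 := hm k.succ_pos
        have := hc.monotone (Fin.zero_le b)
        omega
      have hc' : StrictMono fun b => c b - 1 := fun a b h => by
        have := hc h
        have := hcpos a
        change c a - 1 < c b - 1
        omega
      have hm' : ∀ h : 0 < k + 1, c ⟨0, h⟩ - 1 = m := fun h => by rw [hm h, Nat.add_sub_cancel]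
      let M : Fin (k + 1) → Fin (k + 1) → ℝ := fun a b => (Nat.choose (c b - 1) (r a) : ℝ)
      let M' : Fin (k + 1) → Fin (k + 1) → ℝ := fun a b =>
        if r a = 0 then 0 else (Nat.choose (c b - 1) (r a - 1) : ℝ)
      have hsum : (Matrix.of fun a b => (Nat.choose (c b) (r a) : ℝ)).det =
          ∑ S : Finset (Fin (k + 1)), Matrix.det (S.piecewise M M') := by
        have h := (Matrix.detRowAlternating (n := Fin (k + 1)) (R := ℝ)).map_add_univ M M'
        rw [show (Matrix.of fun a b => (Nat.choose (c b) (r a) : ℝ)) = M + M' from ?_]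
        · exact h
        · ext a b
          obtain ⟨x, hx⟩ := Nat.exists_eq_succ_of_ne_zero (hcpos b).ne'
          rcases hra : r a with _ | y
          · simp [M, M', hra]
          · simp [M, M', hra, hx, Nat.choose_succ_succ, add_comm]
      have hterm : ∀ S : Finset (Fin (k + 1)), (∀ a ∉ S, r a ≠ 0) →
          S.piecewise M M' = Matrix.of fun a b =>
            (Nat.choose (c b - 1) (if a ∈ S then r a else r a - 1) : ℝ) := by
        intro S hS
        ext a b
        by_cases ha : a ∈ S
        · simp [ha, M]
        · simp [ha, M', hS a ha]
      have hnonneg : ∀ S : Finset (Fin (k + 1)), 0 ≤ Matrix.det (S.piecewise M M') := by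
        intro S
        by_cases hS : ∀ a ∉ S, r a ≠ 0
        · have hmono : Monotone fun a => if a ∈ S then r a else r a - 1 := by
            intro a b hab
            rcases hab.eq_or_lt with rfl | hlt
            · exact le_rfl
            · have := hrs hlt
              dsimp only
              split_ifs <;> omega
          rw [hterm S hS]
          exact (ihm _ _ hmono hc' hm').1
        · push Not at hS
          obtain ⟨a, ha, hra⟩ := hS
          exact (Matrix.det_eq_zero_of_row_eq_zero a fun b => by simp [ha, M', hra]).ge
      rw [hsum]
      refine ⟨Finset.sum_nonneg fun S _ => hnonneg S, fun _ hle => ?_⟩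
      refine Finset.sum_pos' (fun S _ => hnonneg S)
        ⟨Finset.univ.filter fun a => r a < c a, Finset.mem_univ _, ?_⟩
      have hstrict : StrictMono fun a =>
          if a ∈ Finset.univ.filter (fun a => r a < c a) then r a else r a - 1 := by
        intro a b hab
        have := hrs hab
        have := hc hab
        have := hle a
        have := hle b
        have := hcpos a
        simp only [Finset.mem_filter, Finset.mem_univ, true_and]
        split_ifs <;> omega
      rw [hterm]
      · refine (ihm _ _ hstrict.monotone hc' hm').2 hstrict fun a => ?_
        have := hle a
        simp only [Finset.mem_filter, Finset.mem_univ, true_and]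
        split_ifs <;> omega
      · intro a ha
        have := hcpos a
        simp only [Finset.mem_filter, Finset.mem_univ, true_and] at ha
        omega

theorem stmt_18 (n : ℕ) (hn : 1 ≤ n) (s : ℝ) (hs : 0 < s)
    (k : ℕ) (hk1 : 1 ≤ k) (hkn : k ≤ n)
    (row col : Fin k → Fin n) (hrow : StrictMono row) (hcol : StrictMono col)
    (hrc : ∀ l, row l ≤ col l) :
    0 < ((Kmat n s).submatrix row col).det := by
  have hpos := (det_choose_nonneg_and_pos k (col ⟨0, hk1⟩) (fun a => row a) (fun a => col a)
    (fun a b h => hrow.monotone h) (fun a b h => hcol h) (fun _ => rfl)).2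
    (fun a b h => hrow h) hrc
  have hK : (Kmat n s).submatrix row col =
      Matrix.of fun a b => (s ^ (row a : ℕ))⁻¹ * (Matrix.of fun a b =>
        s ^ (col b : ℕ) * (Matrix.of fun a b =>
          (Nat.choose (col b) (row a) : ℝ)) a b) a b := by
    ext a b
    simp only [Matrix.submatrix_apply, Kmat, Matrix.of_apply]
    split_ifs with h
    · rw [pow_sub₀ s hs.ne' h]
      ring
    · simp [Nat.choose_eq_zero_of_lt (not_le.mp h)]
  rw [hK, Matrix.det_mul_column, Matrix.det_mul_row]
  exact mul_pos (Finset.prod_pos fun a _ => by positivity)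
    (mul_pos (Finset.prod_pos fun a _ => by positivity) hpos)
end

section
/- The quartic polynomial 32400x⁴ − 10416x³ − 5952x² − 117556x + 27063 has exactly two real roots; equivalently, it has a pair of nonreal complex conjugate roots (approximately −0.736 ± 1.30i) in addition to two real roots (approximately 0.227 and 1.62). -/
/-- The quartic has a real root in each of the intervals `[1/5, 1/4]` and `[3/2, 7/4]`. -/
lemma quartic_exists_real_roots :
    (∃ a ∈ Set.Icc (1 / 5 : ℝ) (1 / 4),
      32400 * a ^ 4 - 10416 * a ^ 3 - 5952 * a ^ 2 - 117556 * a + 27063 = 0) ∧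
    ∃ b ∈ Set.Icc (3 / 2 : ℝ) (7 / 4),
      32400 * b ^ 4 - 10416 * b ^ 3 - 5952 * b ^ 2 - 117556 * b + 27063 = 0 := by
  have hf (s : Set ℝ) : ContinuousOn (fun x : ℝ ↦
      32400 * x ^ 4 - 10416 * x ^ 3 - 5952 * x ^ 2 - 117556 * x + 27063) s := by
    fun_prop
  exact ⟨intermediate_value_Icc' (by norm_num) (hf _) ⟨by norm_num, by norm_num⟩,
    intermediate_value_Icc (by norm_num) (hf _) ⟨by norm_num, by norm_num⟩⟩

/-- Two distinct real roots `a`, `b` split off the quartic; `p` and `q` are the lower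
coefficients of the quadratic cofactor. -/
lemma quartic_eq_mul_quadratic {a b p q : ℝ} (hab : a ≠ b)
    (ha : 32400 * a ^ 4 - 10416 * a ^ 3 - 5952 * a ^ 2 - 117556 * a + 27063 = 0)
    (hb : 32400 * b ^ 4 - 10416 * b ^ 3 - 5952 * b ^ 2 - 117556 * b + 27063 = 0)
    (hp : p = 32400 * (a + b) - 10416)
    (hq : q = p * (a + b) - 32400 * (a * b) - 5952) (z : ℂ) :
    32400 * z ^ 4 - 10416 * z ^ 3 - 5952 * z ^ 2 - 117556 * z + 27063 =
      (z - a) * (z - b) * (32400 * z ^ 2 + p * z + q) := by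
  have h_lin : a * b * p - (a + b) * q = -117556 := by
    subst hq hp
    apply mul_left_cancel₀ (sub_ne_zero.mpr hab)
    linear_combination hb - ha
  have h_const : a * b * q = 27063 := by
    subst hq hp
    linear_combination (-a) * h_lin - ha
  have hpC : (p : ℂ) = 32400 * (a + b) - 10416 := by exact_mod_cast congrArg Complex.ofReal hp
  have hqC : (q : ℂ) = p * (a + b) - 32400 * (a * b) - 5952 := by
    exact_mod_cast congrArg Complex.ofReal hq
  have h_linC : (a : ℂ) * b * p - (a + b) * q = -117556 := by
    exact_mod_cast congrArg Complex.ofReal h_lin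
  have h_constC : (a : ℂ) * b * q = 27063 := by exact_mod_cast congrArg Complex.ofReal h_const
  linear_combination (-z ^ 3) * hpC - z ^ 2 * hqC - z * h_linC - h_constC

/-- A real quadratic with negative discriminant has a nonreal complex root. -/
lemma exists_nonreal_root_of_discrim_neg {k p q : ℝ} (hk : k ≠ 0) (h : discrim k p q < 0) :
    ∃ z : ℂ, z.im ≠ 0 ∧ k * z ^ 2 + p * z + q = 0 := by
  have h_pos : 0 < -discrim k p q := neg_pos.mpr h
  have h_sq : ((√(-discrim k p q) : ℝ) : ℂ) ^ 2 = -(p ^ 2 - 4 * k * q) := by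
    exact_mod_cast congrArg Complex.ofReal (Real.sq_sqrt h_pos.le)
  refine ⟨⟨-p / (2 * k), √(-discrim k p q) / (2 * k)⟩, ?_, ?_⟩
  · exact div_ne_zero (Real.sqrt_pos.mpr h_pos).ne' (mul_ne_zero two_ne_zero hk)
  · have hkC : (k : ℂ) ≠ 0 := by exact_mod_cast hk
    rw [Complex.mk_eq_add_mul_I]
    push_cast
    field_simp
    linear_combination ((√(-discrim k p q) : ℝ) : ℂ) ^ 2 * Complex.I_sq - h_sq

theorem stmt_19 :
    ({x : ℝ | 32400 * x ^ 4 - 10416 * x ^ 3 - 5952 * x ^ 2 - 117556 * x + 27063 = 0}).ncard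
        = 2 ∧
    ∃ z : ℂ, z.im ≠ 0 ∧
      32400 * z ^ 4 - 10416 * z ^ 3 - 5952 * z ^ 2 - 117556 * z + 27063 = 0 ∧
      32400 * (starRingEnd ℂ z) ^ 4 - 10416 * (starRingEnd ℂ z) ^ 3
        - 5952 * (starRingEnd ℂ z) ^ 2 - 117556 * (starRingEnd ℂ z) + 27063 = 0 := by
  obtain ⟨⟨a, ⟨ha₁, ha₂⟩, ha⟩, b, ⟨hb₁, hb₂⟩, hb⟩ := quartic_exists_real_roots
  have hab : a ≠ b := by linarith
  obtain ⟨p, hp⟩ : ∃ p, p = 32400 * (a + b) - 10416 := ⟨_, rfl⟩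
  obtain ⟨q, hq⟩ : ∃ q, q = p * (a + b) - 32400 * (a * b) - 5952 := ⟨_, rfl⟩
  have h_factor := quartic_eq_mul_quadratic hab ha hb hp hq
  have h_discrim : discrim 32400 p q < 0 := by
    have hp₁ : 44664 ≤ p := by linarith
    have hp₂ : p ≤ 54384 := by linarith
    have hps : 44664 * (17 / 10) ≤ p * (a + b) := by gcongr; linarith
    have h_ab : a * b ≤ 1 / 4 * (7 / 4) := by gcongr
    have h_sq : p ^ 2 ≤ 54384 ^ 2 := by gcongr
    unfold discrim
    linarith
  constructor
  · rw [Set.ncard_eq_two]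
    refine ⟨a, b, hab, Set.ext fun x ↦ ⟨fun hx ↦ ?_, ?_⟩⟩
    · have h_prod : (x - a) * (x - b) * (32400 * x ^ 2 + p * x + q) = 0 := by
        have h := h_factor x
        norm_cast at h
        rw [← h]
        exact_mod_cast hx
      have h_quad : 32400 * x ^ 2 + p * x + q ≠ 0 := fun h ↦
        h_discrim.not_ge <| by
          rw [discrim_eq_sq_of_quadratic_eq_zero (x := x) (by linarith)]
          positivity
      simpa [h_quad, sub_eq_zero] using h_prod
    · rintro (rfl | rfl)
      exacts [ha, hb]
  · obtain ⟨z, hz_im, hz⟩ := exists_nonreal_root_of_discrim_neg (by norm_num) h_discrim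
    push_cast at hz
    have h_root : 32400 * z ^ 4 - 10416 * z ^ 3 - 5952 * z ^ 2 - 117556 * z + 27063 = 0 := by
      rw [h_factor, hz, mul_zero]
    refine ⟨z, hz_im, h_root, ?_⟩
    simpa only [map_sub, map_add, map_mul, map_pow, map_ofNat, map_zero] using
      congrArg (starRingEnd ℂ) h_root
end
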